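/- Let ν be any probability measure on ℝ^n whose support is included in the euclidean ball B(0,R), and let ν^σ = ν * γ_σ, where γ_σ is the centered gaussian distribution with covariance matrix σ² Id. If for some ε > 0 one has s := ((1+ε)/4) R²/σ² < 1, then C_P(ν^σ) ≤ ((1+ε⁻¹)/(1−s)) σ². Moreover, for all θ > 0 and β > 0, C_{LS}(ν^σ) ≤ ( 2(β+1)(1+θ⁻¹)/β + 5 (1+ε⁻¹)/(1−s) ) σ² + 2 ((1+ε⁻¹)/(1−s)) ( (1+θ)(1+β)/(4β) + β²/2 ) R². -/

import Mathlib

open MeasureTheory Real Set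
open scoped ENNReal RealInnerProductSpace Pointwise Matrix

noncomputable section

/-- Euclidean space ℝ^n. -/
abbrev En (n : ℕ) := EuclideanSpace ℝ (Fin n)

/-- Test functions: smooth, bounded and Lipschitz. -/
def IsTestFun {n : ℕ} (f : En n → ℝ) : Prop :=
  ContDiff ℝ (⊤ : ℕ∞) f ∧ (∃ M, ∀ x, |f x| ≤ M) ∧ ∃ L, LipschitzWith L f

/-- `μ` satisfies a Poincaré inequality with constant `C`. -/
def PoincareLE {n : ℕ} (μ : Measure (En n)) (C : ℝ) : Prop :=
  ∀ f : En n → ℝ, IsTestFun f →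
    (∫ x, (f x) ^ 2 ∂μ) - (∫ x, f x ∂μ) ^ 2 ≤ C * ∫ x, ‖gradient f x‖ ^ 2 ∂μ

/-- `μ` satisfies a logarithmic Sobolev inequality with constant `C`. -/
def LogSobolevLE {n : ℕ} (μ : Measure (En n)) (C : ℝ) : Prop :=
  ∀ f : En n → ℝ, IsTestFun f →
    (∫ x, (f x) ^ 2 * Real.log ((f x) ^ 2) ∂μ)
        - (∫ x, (f x) ^ 2 ∂μ) * Real.log (∫ x, (f x) ^ 2 ∂μ)
      ≤ C * ∫ x, ‖gradient f x‖ ^ 2 ∂μ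

/-- `μ` satisfies an L¹-Poincaré inequality (around the mean) with constant `C`. -/
def CheegerMeanLE {n : ℕ} (μ : Measure (En n)) (C : ℝ) : Prop :=
  ∀ f : En n → ℝ, IsTestFun f →
    ∫ x, |f x - ∫ y, f y ∂μ| ∂μ ≤ C * ∫ x, ‖gradient f x‖ ∂μ

/-- `m` is a median of `f` under `μ`. -/
def IsMedian {n : ℕ} (μ : Measure (En n)) (f : En n → ℝ) (m : ℝ) : Prop :=
  ENNReal.ofReal (1 / 2) ≤ μ {x | f x ≤ m} ∧ ENNReal.ofReal (1 / 2) ≤ μ {x | m ≤ f x}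

/-- `μ` satisfies a Cheeger inequality (around medians) with constant `C`. -/
def CheegerMedianLE {n : ℕ} (μ : Measure (En n)) (C : ℝ) : Prop :=
  ∀ f : En n → ℝ, IsTestFun f → ∀ m : ℝ, IsMedian μ f m →
    ∫ x, |f x - m| ∂μ ≤ C * ∫ x, ‖gradient f x‖ ∂μ

/-- The perturbed (normalized) measure `μ_F = Z_F⁻¹ e^{-F} μ`. -/
def perturb {n : ℕ} (μ : Measure (En n)) (F : En n → ℝ) : Measure (En n) :=
  (ENNReal.ofReal (∫ x, Real.exp (-F x) ∂μ))⁻¹ •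
    μ.withDensity fun x => ENNReal.ofReal (Real.exp (-F x))

/-- Topological support of a measure. -/
def measSupport {n : ℕ} (μ : Measure (En n)) : Set (En n) :=
  {x | ∀ U ∈ nhds x, 0 < μ U}

/-- `μ` is log-concave: it has density `e^{-W}` on a convex set, with `W` convex
(equivalently, density `e^{-W}` with `W : ℝⁿ → ℝ ∪ {+∞}` convex). -/
def IsLogConcave {n : ℕ} (μ : Measure (En n)) : Prop :=
  ∃ (s : Set (En n)) (W : En n → ℝ), Convex ℝ s ∧ ConvexOn ℝ s W ∧
    μ = volume.withDensity (s.indicator fun x => ENNReal.ofReal (Real.exp (-W x)))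

/-- The Laplacian of `F`. -/
def laplacian {n : ℕ} (F : En n → ℝ) (x : En n) : ℝ :=
  ∑ i : Fin n,
    fderiv ℝ (fun y => fderiv ℝ F y (EuclideanSpace.single i (1 : ℝ))) x
      (EuclideanSpace.single i (1 : ℝ))

/-- The generator `A F = ΔF - ∇V·∇F` associated with `μ = e^{-V} dx`. -/
def genA {n : ℕ} (V F : En n → ℝ) (x : En n) : ℝ :=
  laplacian F x - ⟪gradient V x, gradient F x⟫

/-- The centered Gaussian measure on ℝ^n with covariance matrix `σ² Id`. -/
def gaussMeasure (n : ℕ) (σ : ℝ) : Measure (En n) :=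
  volume.withDensity fun x =>
    ENNReal.ofReal ((2 * π * σ ^ 2) ^ (-(n : ℝ) / 2) * Real.exp (-‖x‖ ^ 2 / (2 * σ ^ 2)))

/-- Convolution of two measures. -/
def mconv {n : ℕ} (μ ν : Measure (En n)) : Measure (En n) :=
  (μ.prod ν).map fun p => p.1 + p.2

/-- Concentration profile of `μ`. -/
def concProfile {n : ℕ} (μ : Measure (En n)) (r : ℝ) : ℝ :=
  sSup {t | ∃ A : Set (En n), MeasurableSet A ∧ (1 : ℝ) / 2 ≤ (μ A).toReal ∧
    t = 1 - (μ (A + Metric.ball (0 : En n) r)).toReal}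

/-- Generalized inverse of the concentration profile. -/
def concInv {n : ℕ} (μ : Measure (En n)) (s : ℝ) : ℝ :=
  sInf {r | 0 < r ∧ concProfile μ r ≤ s}

/-- The Hessian matrix of `V` at `x`. -/
def hessMat {n : ℕ} (V : En n → ℝ) (x : En n) : Matrix (Fin n) (Fin n) ℝ :=
  fun i j =>
    fderiv ℝ (fun y => fderiv ℝ V y (EuclideanSpace.single j (1 : ℝ))) x
      (EuclideanSpace.single i (1 : ℝ))

end


/-- Young's inequality for the conjugate pair `a log a - a`, `exp t`. -/
lemma mul_le_mul_log_sub_add_exp {a : ℝ} (ha : 0 ≤ a) (t : ℝ) :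
    a * t ≤ a * Real.log a - a + Real.exp t := by
  rcases ha.eq_or_lt with rfl | ha
  · simpa using (Real.exp_pos t).le
  · have h := Real.add_one_le_exp (t - Real.log a)
    rw [Real.exp_sub, Real.exp_log ha, le_div_iff₀ ha] at h
    linarith

lemma mul_log_le_mul_log_sub_add {a b : ℝ} (ha : 0 ≤ a) (hb : 0 < b) :
    a * Real.log b ≤ a * Real.log a - a + b := by
  simpa [Real.exp_log hb] using mul_le_mul_log_sub_add_exp ha (Real.log b)

lemma abs_mul_log_le (t : ℝ) : |t * Real.log t| ≤ 1 + t ^ 2 := by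
  rcases eq_or_ne t 0 with rfl | h0
  · simp
  have h1 := Real.log_le_sub_one_of_pos (abs_pos.2 h0)
  have h2 := Real.log_le_sub_one_of_pos (inv_pos.2 (abs_pos.2 h0))
  rw [Real.log_inv] at h2
  rw [abs_mul, ← Real.log_abs t, ← sq_abs t]
  have hp := abs_pos.2 h0
  have h3 : |t| * |t|⁻¹ = 1 := mul_inv_cancel₀ hp.ne'
  rcases abs_cases (Real.log |t|) with ⟨h, _⟩ | ⟨h, _⟩ <;> rw [h] <;> nlinarith

lemma hasDerivAt_mul_mul_log (x : ℝ) :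
    HasDerivAt (fun u : ℝ ↦ u * (u * Real.log u)) (2 * (x * Real.log x) + x) x := by
  rcases eq_or_ne x 0 with rfl | hx
  · have h := Real.continuous_mul_log.tendsto 0
    rw [hasDerivAt_iff_tendsto_slope]
    simp only [mul_zero, zero_mul, add_zero] at h ⊢
    refine (h.mono_left nhdsWithin_le_nhds).congr' ?_
    filter_upwards [self_mem_nhdsWithin] with y hy
    have : y ≠ 0 := hy
    rw [slope_def_field]
    field_simp
    ring
  · refine ((hasDerivAt_id x).mul (Real.hasDerivAt_mul_log hx)).congr_deriv ?_
    simp only [id]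
    ring

lemma monotone_of_deriv_nonneg_of_ne {N : ℝ → ℝ} (hc : Continuous N) {a : ℝ}
    (hd : ∀ x ≠ a, ∃ d, 0 ≤ d ∧ HasDerivAt N d x) : Monotone N := by
  have hl : MonotoneOn N (Iic a) := by
    refine monotoneOn_of_deriv_nonneg (convex_Iic a) hc.continuousOn ?_ ?_ <;> intro x hx <;>
      rw [interior_Iic] at hx <;> obtain ⟨d, hd0, hd⟩ := hd x (show x < a from hx).ne
    · exact hd.differentiableAt.differentiableWithinAt
    · rwa [hd.deriv]
  have hr : MonotoneOn N (Ici a) := by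
    refine monotoneOn_of_deriv_nonneg (convex_Ici a) hc.continuousOn ?_ ?_ <;> intro x hx <;>
      rw [interior_Ici] at hx <;> obtain ⟨d, hd0, hd⟩ := hd x (show a < x from hx).ne'
    · exact hd.differentiableAt.differentiableWithinAt
    · rwa [hd.deriv]
  have := hl.union_right hr isGreatest_Iic isLeast_Ici
  rwa [Iic_union_Ici, monotoneOn_univ] at this

lemma le_of_hasDerivAt_of_monotone {N N' : ℝ → ℝ} (hd : ∀ x, HasDerivAt N (N' x) x)
    (hm : Monotone N') {a : ℝ} (ha : N' a = 0) (u : ℝ) : N a ≤ N u := by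
  have hc : Continuous N := continuous_iff_continuousAt.2 fun x ↦ (hd x).continuousAt
  have hdiff : Differentiable ℝ N := fun x ↦ (hd x).differentiableAt
  rcases le_total u a with h | h
  · refine antitoneOn_of_deriv_nonpos (convex_Iic a) hc.continuousOn hdiff.differentiableOn
      (fun x hx ↦ ?_) h (mem_Iic.2 le_rfl) h
    rw [interior_Iic] at hx
    rw [(hd x).deriv, ← ha]
    exact hm (le_of_lt hx)
  · refine monotoneOn_of_deriv_nonneg (convex_Ici a) hc.continuousOn hdiff.differentiableOn
      (fun x hx ↦ ?_) (mem_Ici.2 le_rfl) h h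
    rw [interior_Ici] at hx
    rw [(hd x).deriv, ← ha]
    exact hm (le_of_lt hx)

lemma mul_log_sq_le_of_pos {Q : ℝ} (hQ : 0 < Q) (u : ℝ) :
    u ^ 2 * Real.log (u ^ 2) ≤
      2 * (u - 1) + (2 + Real.log Q) * (u - 1) ^ 2 + (u ^ 4 - 4 * u + 3) / (6 * Q) := by
  have hd : ∀ x, HasDerivAt (fun u : ℝ ↦ 2 * (u - 1) + (2 + Real.log Q) * (u - 1) ^ 2
      + (u ^ 4 - 4 * u + 3) / (6 * Q) - 2 * (u * (u * Real.log u)))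
      (2 + (2 + Real.log Q) * (2 * (x - 1)) + (4 * x ^ 3 - 4) / (6 * Q)
        - 2 * (2 * (x * Real.log x) + x)) x := by
    intro x
    have h2 : HasDerivAt (fun u : ℝ ↦ u - 1) 1 x := (hasDerivAt_id x).sub_const 1
    have h3 := (((hasDerivAt_pow 4 x).sub ((hasDerivAt_id x).const_mul 4)).add_const 3).div_const
      (6 * Q)
    refine ((((h2.const_mul 2).add ((h2.pow 2).const_mul (2 + Real.log Q))).add h3).sub
      ((hasDerivAt_mul_mul_log x).const_mul 2)).congr_deriv ?_
    norm_num
  have hm : Monotone (fun x ↦ 2 + (2 + Real.log Q) * (2 * (x - 1)) + (4 * x ^ 3 - 4) / (6 * Q)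
        - 2 * (2 * (x * Real.log x) + x)) := by
    refine monotone_of_deriv_nonneg_of_ne (a := 0) ?_ fun x hx ↦ ?_
    · have := Real.continuous_mul_log
      fun_prop
    · have h2 : HasDerivAt (fun u : ℝ ↦ u - 1) 1 x := (hasDerivAt_id x).sub_const 1
      have h3 := (((hasDerivAt_pow 3 x).const_mul 4).sub_const 4).div_const (6 * Q)
      refine ⟨_, ?_, ((((h2.const_mul 2).const_mul (2 + Real.log Q)).const_add 2).add h3).sub
        ((((Real.hasDerivAt_mul_log hx).const_mul 2).add (hasDerivAt_id x)).const_mul 2)⟩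
      have h6 := Real.log_le_sub_one_of_pos (div_pos (sq_pos_of_ne_zero hx) hQ)
      rw [Real.log_div (by positivity) hQ.ne', Real.log_pow] at h6
      have h7 : 4 * (((3 : ℕ) : ℝ) * x ^ (3 - 1)) / (6 * Q) = 2 * (x ^ 2 / Q) := by
        field_simp; norm_num
      rw [h7]
      push_cast at h6
      linarith
  have hmain := le_of_hasDerivAt_of_monotone hd hm (a := 1) (by simp) u
  norm_num at hmain
  rw [Real.log_pow]
  push_cast
  linarith

/-- A pointwise form of Rothaus' lemma. -/
lemma one_add_sq_mul_log_le (z : ℝ) :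
    (1 + z) ^ 2 * Real.log ((1 + z) ^ 2) ≤
      2 * z + 3 * z ^ 2 + z ^ 2 * Real.log (1 + 2 * z / 3 + z ^ 2 / 6) := by
  have hQ : 0 < 1 + 2 * z / 3 + z ^ 2 / 6 := by nlinarith [sq_nonneg (z + 2)]
  have h := mul_log_sq_le_of_pos hQ (1 + z)
  have h2 : ((1 + z) ^ 4 - 4 * (1 + z) + 3) / (6 * (1 + 2 * z / 3 + z ^ 2 / 6)) = z ^ 2 := by
    rw [div_eq_iff (by positivity)]; ring
  rw [h2] at h
  linarith

lemma add_mul_log_one_add_div_six_le {τ : ℝ} (hτ : 0 ≤ τ) :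
    τ + τ * Real.log (1 + τ / 6) ≤ (1 + τ) * Real.log (1 + τ) := by
  have h1 := Real.le_log_one_add_of_nonneg hτ
  have h2 := Real.le_log_one_add_of_nonneg (x := 5 * τ / (6 + τ)) (by positivity)
  have h3 : 1 + 5 * τ / (6 + τ) = (1 + τ) / (1 + τ / 6) := by field_simp; ring
  rw [h3, Real.log_div (by positivity) (by positivity)] at h2
  have h4 : 2 * (5 * τ / (6 + τ)) / (5 * τ / (6 + τ) + 2) = 10 * τ / (12 + 7 * τ) := by
    field_simp; ring
  rw [h4] at h2
  have h5 : τ ≤ 2 * τ / (τ + 2) + τ * (10 * τ / (12 + 7 * τ)) := by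
    have : 2 * τ / (τ + 2) + τ * (10 * τ / (12 + 7 * τ)) - τ
        = τ * (8 * τ + 3 * τ ^ 2) / ((τ + 2) * (12 + 7 * τ)) := by
      field_simp; ring
    have : 0 ≤ τ * (8 * τ + 3 * τ ^ 2) / ((τ + 2) * (12 + 7 * τ)) := by positivity
    linarith
  nlinarith [mul_le_mul_of_nonneg_left h2 hτ]

/-- The entropy `∫ u log u - (∫ u) log (∫ u)` of a function. -/
noncomputable def entropy {α : Type*} [MeasurableSpace α] (μ : Measure α) (u : α → ℝ) : ℝ :=
  (∫ x, u x * Real.log (u x) ∂μ) - (∫ x, u x ∂μ) * Real.log (∫ x, u x ∂μ)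

lemma integrable_of_abs_le {α : Type*} [MeasurableSpace α] {μ : Measure α} [IsFiniteMeasure μ]
    {u : α → ℝ} {M : ℝ} (hu : Measurable u) (hM : ∀ x, |u x| ≤ M) : Integrable u μ :=
  .of_bound hu.aestronglyMeasurable M (.of_forall hM)

lemma measurable_mul_log {α : Type*} [MeasurableSpace α] {u : α → ℝ} (hu : Measurable u) :
    Measurable fun x ↦ u x * Real.log (u x) :=
  hu.mul (Real.measurable_log.comp hu)

lemma integrable_mul_log_of_abs_le {α : Type*} [MeasurableSpace α] {μ : Measure α}
    [IsFiniteMeasure μ] {u : α → ℝ} {M : ℝ} (hu : Measurable u) (hM : ∀ x, |u x| ≤ M) :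
    Integrable (fun x ↦ u x * Real.log (u x)) μ := by
  refine integrable_of_abs_le (M := 1 + M ^ 2) (measurable_mul_log hu) fun x ↦ ?_
  refine (abs_mul_log_le _).trans ?_
  have := sq_le_sq' (by linarith [(abs_le.1 (hM x)).1]) (abs_le.1 (hM x)).2
  linarith

lemma add_sq_mul_log_le {m τ : ℝ} (hm : m ≠ 0) (hτ : 0 < τ) (g : ℝ) :
    (m + g) ^ 2 * Real.log ((m + g) ^ 2) ≤
      (m ^ 2 * Real.log (m ^ 2) + m ^ 2 * (τ / (1 + τ / 6))) +
      (2 * m * Real.log (m ^ 2) + 2 * m + 2 * m * (τ / (1 + τ / 6)) / 3) * g +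
      (2 + τ / (1 + τ / 6) / 6 + Real.log (1 + τ / 6) - Real.log τ) * g ^ 2 +
      g ^ 2 * Real.log (g ^ 2) := by
  obtain ⟨z, rfl⟩ : ∃ z, g = m * z := ⟨g / m, by field_simp⟩
  have hm2 : 0 < m ^ 2 := by positivity
  have hQ : 0 < 1 + 2 * z / 3 + z ^ 2 / 6 := by nlinarith [sq_nonneg (z + 2)]
  have hk : 0 < τ / (1 + τ / 6) := by positivity
  have h1 := one_add_sq_mul_log_le z
  have h2 := mul_log_le_mul_log_sub_add (sq_nonneg z) (mul_pos hQ hk)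
  rw [Real.log_mul hQ.ne' hk.ne', Real.log_div hτ.ne' (by positivity)] at h2
  have h3 : (m + m * z) ^ 2 * Real.log ((m + m * z) ^ 2) =
      m ^ 2 * ((1 + z) ^ 2 * Real.log (m ^ 2) + (1 + z) ^ 2 * Real.log ((1 + z) ^ 2)) := by
    rcases eq_or_ne (1 + z) 0 with h | h
    · have : m + m * z = 0 := by linear_combination m * h
      simp [this, h]
    · rw [show (m + m * z) ^ 2 = m ^ 2 * (1 + z) ^ 2 by ring,
        Real.log_mul hm2.ne' (by positivity)]
      ring
  have h4 : (m * z) ^ 2 * Real.log ((m * z) ^ 2) =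
      m ^ 2 * (z ^ 2 * Real.log (m ^ 2) + z ^ 2 * Real.log (z ^ 2)) := by
    rcases eq_or_ne z 0 with rfl | h
    · simp
    · rw [mul_pow, Real.log_mul hm2.ne' (by positivity)]
      ring
  rw [h3, h4]
  have := mul_le_mul_of_nonneg_left (add_le_add h1 h2) hm2.le
  nlinarith

lemma entropy_const_add_sq_le {α : Type*} [MeasurableSpace α] (μ : Measure α)
    [IsProbabilityMeasure μ] {g : α → ℝ} (hgm : Measurable g) {M : ℝ} (hgM : ∀ x, |g x| ≤ M)
    (hg0 : ∫ x, g x ∂μ = 0) (m : ℝ) :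
    entropy μ (fun x ↦ (m + g x) ^ 2) ≤
      entropy μ (fun x ↦ g x ^ 2) + 2 * ∫ x, g x ^ 2 ∂μ := by
  have hg : Integrable g μ := integrable_of_abs_le hgm hgM
  have hgM2 : ∀ x, |g x ^ 2| ≤ M ^ 2 := fun x ↦ by
    rw [abs_pow]; exact pow_le_pow_left₀ (abs_nonneg _) (hgM x) 2
  have hg2 : Integrable (fun x ↦ g x ^ 2) μ := integrable_of_abs_le (hgm.pow_const 2) hgM2
  have hgl := integrable_mul_log_of_abs_le (μ := μ) (hgm.pow_const 2) hgM2
  have hfl : Integrable (fun x ↦ (m + g x) ^ 2 * Real.log ((m + g x) ^ 2)) μ :=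
    integrable_mul_log_of_abs_le (M := (|m| + M) ^ 2)
      ((hgm.const_add m).pow_const 2) fun x ↦ by
        rw [abs_pow]
        exact pow_le_pow_left₀ (abs_nonneg _)
          ((abs_add_le _ _).trans (add_le_add_right (hgM x) _)) 2
  set N := ∫ x, g x ^ 2 ∂μ with hN
  have hN0 : 0 ≤ N := integral_nonneg fun x ↦ sq_nonneg _
  have hi1 : ∀ A B : ℝ, Integrable (fun x ↦ A + B * g x) μ :=
    fun A B ↦ (integrable_const A).add (hg.const_mul B)
  have hi2 : ∀ A B C : ℝ, Integrable (fun x ↦ A + B * g x + C * g x ^ 2) μ :=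
    fun A B C ↦ (hi1 A B).add (hg2.const_mul C)
  have hquad : ∀ A B C : ℝ, ∫ x, (A + B * g x + C * g x ^ 2) ∂μ = A + C * N := by
    intro A B C
    rw [integral_add (hi1 A B) (hg2.const_mul C),
      integral_add (integrable_const A) (hg.const_mul B), integral_const_mul,
      integral_const_mul, hg0]
    simp [hN]
  have hfN : ∫ x, (m + g x) ^ 2 ∂μ = m ^ 2 + N := by
    rw [← one_mul N, ← hquad (m ^ 2) (2 * m) 1]
    congr with x
    ring
  by_cases hm0 : m = 0
  · simp only [entropy, hm0, zero_add]
    linarith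
  rcases hN0.eq_or_lt with hN1 | hN1
  · have hz : ∀ᵐ x ∂μ, g x = 0 := by
      have := (integral_eq_zero_iff_of_nonneg (fun x ↦ sq_nonneg (g x)) hg2).1 hN1.symm
      filter_upwards [this] with x hx
      simpa using hx
    have h1 : ∫ x, (m + g x) ^ 2 * Real.log ((m + g x) ^ 2) ∂μ = m ^ 2 * Real.log (m ^ 2) := by
      rw [integral_congr_ae (g := fun _ ↦ m ^ 2 * Real.log (m ^ 2))]
      · simp
      · filter_upwards [hz] with x hx
        simp [hx]
    have h2 : ∫ x, g x ^ 2 * Real.log (g x ^ 2) ∂μ = 0 := by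
      rw [integral_congr_ae (g := fun _ ↦ 0)]
      · simp
      · filter_upwards [hz] with x hx
        simp [hx]
    simp only [entropy]
    rw [h1, h2, hfN, ← hN, ← hN1]
    simp
  · have hm2 : 0 < m ^ 2 := by positivity
    set τ := N / m ^ 2 with hτ
    have hτ0 : 0 < τ := by positivity
    have hτN : N = m ^ 2 * τ := by rw [hτ]; field_simp
    have hint := integral_mono hfl ((hi2 _ _ _).add hgl)
      (fun x ↦ add_sq_mul_log_le hm0 hτ0 (g x))
    rw [integral_add' (hi2 _ _ _) hgl, hquad] at hint
    simp only [entropy]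
    rw [hfN, ← hN]
    have h1 := mul_le_mul_of_nonneg_left (add_mul_log_one_add_div_six_le hτ0.le) hm2.le
    have h2 : Real.log N = Real.log (m ^ 2) + Real.log τ := by
      rw [hτN, Real.log_mul hm2.ne' hτ0.ne']
    have h3 : Real.log (m ^ 2 + N) = Real.log (m ^ 2) + Real.log (1 + τ) := by
      rw [← Real.log_mul hm2.ne' (by positivity), hτN]
      ring_nf
    have h4 : m ^ 2 * (τ / (1 + τ / 6)) + τ / (1 + τ / 6) / 6 * N = N := by
      rw [hτN]; field_simp
    rw [h2, h3]
    rw [hτN] at h4 hint ⊢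
    linarith

/-- **Rothaus' lemma**. -/
lemma entropy_sq_le_entropy_sub_mean_sq {α : Type*} [MeasurableSpace α] (μ : Measure α)
    [IsProbabilityMeasure μ] {f : α → ℝ} (hf : Measurable f) {M : ℝ} (hM : ∀ x, |f x| ≤ M) :
    entropy μ (fun x ↦ f x ^ 2) ≤
      entropy μ (fun x ↦ (f x - ∫ y, f y ∂μ) ^ 2) + 2 * ∫ x, (f x - ∫ y, f y ∂μ) ^ 2 ∂μ := by
  have h := entropy_const_add_sq_le μ (g := fun x ↦ f x - ∫ y, f y ∂μ) (hf.sub_const _)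
    (M := M + |∫ y, f y ∂μ|) (fun x ↦ (abs_sub _ _).trans (add_le_add_left (hM x) _))
    (by rw [integral_sub (integrable_of_abs_le hf hM) (integrable_const _)]; simp)
    (∫ y, f y ∂μ)
  simpa only [add_sub_cancel] using h

lemma abs_entropy_le {α : Type*} [MeasurableSpace α] (μ : Measure α) [IsProbabilityMeasure μ]
    {u : α → ℝ} {M : ℝ} (hM : ∀ x, |u x| ≤ M) : |entropy μ u| ≤ 2 * (1 + M ^ 2) := by
  have hsq : ∀ t : ℝ, |t| ≤ M → |t * Real.log t| ≤ 1 + M ^ 2 := fun t ht ↦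
    (abs_mul_log_le t).trans (by
      have := sq_le_sq' (by linarith [(abs_le.1 ht).1]) (abs_le.1 ht).2
      linarith)
  have h1 : ‖∫ x, u x * Real.log (u x) ∂μ‖ ≤ (1 + M ^ 2) * μ.real univ :=
    norm_integral_le_of_norm_le_const (.of_forall fun x ↦ hsq _ (hM x))
  have h2 : ‖∫ x, u x ∂μ‖ ≤ M * μ.real univ :=
    norm_integral_le_of_norm_le_const (.of_forall hM)
  rw [probReal_univ, mul_one] at h1 h2
  rw [Real.norm_eq_abs] at h1 h2
  refine (abs_sub _ _).trans ?_
  linarith [hsq _ h2]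

lemma measurable_entropy_left {α β : Type*} [MeasurableSpace α] [MeasurableSpace β]
    (μ : Measure α) [SFinite μ] {u : β → α → ℝ} (hu : Measurable (Function.uncurry u)) :
    Measurable fun y ↦ entropy μ (u y) := by
  have h1 : Measurable fun y ↦ ∫ x, u y x ∂μ :=
    hu.stronglyMeasurable.integral_prod_right.measurable
  have h2 : Measurable fun y ↦ ∫ x, u y x * Real.log (u y x) ∂μ :=
    (measurable_mul_log hu).stronglyMeasurable.integral_prod_right.measurable
  exact h2.sub (measurable_mul_log h1)

/-- The entropic duality inequality. -/
lemma integral_mul_log_sub_le_entropy {α : Type*} [MeasurableSpace α] (μ : Measure α)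
    [IsProbabilityMeasure μ] {u G : α → ℝ} (hu0 : ∀ x, 0 ≤ u x) (hu : Integrable u μ)
    (hul : Integrable (fun x ↦ u x * Real.log (u x)) μ) (hG0 : ∀ x, 0 < G x)
    (hG : Integrable G μ) (hGl : Integrable (fun x ↦ u x * Real.log (G x)) μ)
    (hA : 0 < ∫ x, u x ∂μ) :
    ∫ x, u x * Real.log (G x) ∂μ - (∫ x, u x ∂μ) * Real.log (∫ x, G x ∂μ) ≤ entropy μ u := by
  set A := ∫ x, u x ∂μ with hAdef
  set B := ∫ x, G x ∂μ with hBdef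
  have hB : 0 < B := by
    refine (integral_pos_iff_support_of_nonneg (fun x ↦ (hG0 x).le) hG).2 ?_
    rw [show Function.support G = univ from eq_univ_of_forall fun x ↦ (hG0 x).ne']
    simp
  have hpt : ∀ x, u x * Real.log (G x) + (Real.log A - Real.log B) * u x ≤
      u x * Real.log (u x) - u x + A / B * G x := fun x ↦ by
    have h := mul_log_le_mul_log_sub_add (hu0 x) (mul_pos (div_pos hA hB) (hG0 x))
    rw [Real.log_mul (div_pos hA hB).ne' (hG0 x).ne', Real.log_div hA.ne' hB.ne'] at h
    linarith
  have h := integral_mono (hGl.add (hu.const_mul (Real.log A - Real.log B)))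
    ((hul.sub hu).add (hG.const_mul (A / B))) hpt
  rw [integral_add' hGl (hu.const_mul _), integral_add' (hul.sub hu) (hG.const_mul _),
    integral_sub' hul hu, integral_const_mul, integral_const_mul, ← hAdef, ← hBdef,
    div_mul_cancel₀ _ hB.ne'] at h
  simp only [entropy, ← hAdef]
  linarith

lemma entropy_prod_le {α β : Type*} [MeasurableSpace α] [MeasurableSpace β] (μ : Measure α)
    (ν : Measure β) [IsProbabilityMeasure μ] [IsProbabilityMeasure ν] {u : α × β → ℝ}
    (hu : Measurable u) {c C : ℝ} (hc : 0 < c) (hcu : ∀ p, c ≤ u p) (huC : ∀ p, u p ≤ C) :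
    entropy (μ.prod ν) u ≤ ∫ y, entropy μ (fun x ↦ u (x, y)) ∂ν +
      ∫ x, entropy ν (fun y ↦ u (x, y)) ∂μ := by
  have habs : ∀ p, |u p| ≤ C := fun p ↦ by
    rw [abs_of_nonneg (hc.le.trans (hcu p))]; exact huC p
  have hi : Integrable u (μ.prod ν) := integrable_of_abs_le hu habs
  have hil := integrable_mul_log_of_abs_le (μ := μ.prod ν) hu habs
  have hsx : ∀ x, Measurable fun y ↦ u (x, y) := fun x ↦ hu.comp measurable_prodMk_left
  have hsy : ∀ y, Measurable fun x ↦ u (x, y) := fun y ↦ hu.comp measurable_prodMk_right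
  set g : β → ℝ := fun y ↦ ∫ x, u (x, y) ∂μ with hg
  have hgm : Measurable g := hu.stronglyMeasurable.integral_prod_left'.measurable
  have hcg : ∀ y, c ≤ g y := fun y ↦ by
    have := integral_mono (integrable_const c)
      (integrable_of_abs_le (μ := μ) (hsy y) fun x ↦ habs _) (fun x ↦ hcu (x, y))
    simpa using this
  have hgC : ∀ y, g y ≤ C := fun y ↦ by
    have := integral_mono (integrable_of_abs_le (μ := μ) (hsy y) fun x ↦ habs _)
      (integrable_const C) (fun x ↦ huC (x, y))
    simpa using this
  have hgabs : ∀ y, |g y| ≤ C := fun y ↦ by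
    rw [abs_of_nonneg (hc.le.trans (hcg y))]; exact hgC y
  have hgi : Integrable g ν := integrable_of_abs_le hgm hgabs
  have hlogg : ∀ y, |Real.log (g y)| ≤ |Real.log c| + |Real.log C| := fun y ↦ by
    have h1 := Real.log_le_log hc (hcg y)
    have h2 := Real.log_le_log (hc.trans_le (hcg y)) (hgC y)
    rw [abs_le]
    constructor <;> linarith [neg_abs_le (Real.log c), le_abs_self (Real.log C),
      abs_nonneg (Real.log c), abs_nonneg (Real.log C)]
  have hlm : Measurable fun p : α × β ↦ u p * Real.log (g p.2) :=
    hu.mul (Real.measurable_log.comp (hgm.comp measurable_snd))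
  have hlabs : ∀ p : α × β, |u p * Real.log (g p.2)| ≤ C * (|Real.log c| + |Real.log C|) :=
    fun p ↦ by
      rw [abs_mul]
      exact mul_le_mul (habs p) (hlogg _) (abs_nonneg _) ((abs_nonneg _).trans (habs p))
  have hli : Integrable (fun p : α × β ↦ u p * Real.log (g p.2)) (μ.prod ν) :=
    integrable_of_abs_le hlm hlabs
  have hA : ∫ p, u p ∂(μ.prod ν) = ∫ y, g y ∂ν := integral_prod_symm u hi
  have hleft : ∫ y, entropy μ (fun x ↦ u (x, y)) ∂ν =
      ∫ p, u p * Real.log (u p) ∂(μ.prod ν) - ∫ y, g y * Real.log (g y) ∂ν := by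
    rw [integral_prod_symm _ hil, ← integral_sub hil.integral_prod_right
      (integrable_mul_log_of_abs_le hgm hgabs)]
    rfl
  have hright : ∫ y, g y * Real.log (g y) ∂ν - (∫ y, g y ∂ν) * Real.log (∫ y, g y ∂ν) ≤
      ∫ x, entropy ν (fun y ↦ u (x, y)) ∂μ := by
    have h1 : ∫ y, g y * Real.log (g y) ∂ν = ∫ x, ∫ y, u (x, y) * Real.log (g y) ∂ν ∂μ := by
      rw [← integral_prod _ hli, integral_prod_symm _ hli]
      exact integral_congr_ae (.of_forall fun y ↦ (integral_mul_const _ _).symm)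
    have h2 : (∫ y, g y ∂ν) * Real.log (∫ y, g y ∂ν) =
        ∫ x, (∫ y, u (x, y) ∂ν) * Real.log (∫ y, g y ∂ν) ∂μ := by
      rw [integral_mul_const, ← integral_prod _ hi, hA]
    rw [h1, h2, ← integral_sub hli.integral_prod_left (hi.integral_prod_left.mul_const _)]
    refine integral_mono (hli.integral_prod_left.sub (hi.integral_prod_left.mul_const _))
      (integrable_of_abs_le (measurable_entropy_left ν hu)
        fun x ↦ abs_entropy_le ν fun y ↦ habs _) fun x ↦ ?_
    refine integral_mul_log_sub_le_entropy ν (fun y ↦ hc.le.trans (hcu _))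
      (integrable_of_abs_le (hsx x) fun y ↦ habs _)
      (integrable_mul_log_of_abs_le (hsx x) fun y ↦ habs _) (fun y ↦ hc.trans_le (hcg y)) hgi
      (integrable_of_abs_le (hlm.comp measurable_prodMk_left) fun y ↦ hlabs (x, y)) ?_
    refine hc.trans_le ?_
    have := integral_mono (integrable_const c)
      (integrable_of_abs_le (μ := ν) (hsx x) fun x ↦ habs _) (fun y ↦ hcu (x, y))
    simpa using this
  rw [hleft]
  simp only [entropy, hA] at hright ⊢
  linarith

/-- **Subadditivity of the entropy** for product measures. -/
lemma entropy_pi_le {E : Type*} [MeasurableSpace E] (μ : Measure E) [IsProbabilityMeasure μ]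
    {c C : ℝ} (hc : 0 < c) :
    ∀ (n : ℕ) {u : (Fin n → E) → ℝ}, Measurable u → (∀ x, c ≤ u x) → (∀ x, u x ≤ C) →
      entropy (Measure.pi fun _ ↦ μ) u ≤
        ∑ i, ∫ x, entropy μ (fun t ↦ u (Function.update x i t)) ∂(Measure.pi fun _ ↦ μ)
  | 0, u, hu, hcu, huC => by
    have : u = fun _ ↦ u default := funext fun x ↦ by rw [Subsingleton.elim x default]
    rw [this]
    simp [entropy]
  | n + 1, u, hu, hcu, huC => by
    have habs : ∀ p, |u p| ≤ C := fun p ↦ by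
      rw [abs_of_nonneg (hc.le.trans (hcu p))]; exact huC p
    set e := MeasurableEquiv.piFinSuccAbove (fun _ : Fin (n + 1) ↦ E) 0 with he
    have hmp : MeasurePreserving e.symm (μ.prod (Measure.pi fun _ : Fin n ↦ μ))
        (Measure.pi fun _ ↦ μ) := (measurePreserving_piFinSuccAbove (fun _ ↦ μ) 0).symm
    have hint : ∀ f : (Fin (n + 1) → E) → ℝ, ∫ x, f x ∂(Measure.pi fun _ ↦ μ) =
        ∫ p, f (e.symm p) ∂(μ.prod (Measure.pi fun _ : Fin n ↦ μ)) :=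
      fun f ↦ (hmp.integral_comp' f).symm
    have hsymm : ∀ p, e.symm p = Fin.cons p.1 p.2 := fun p ↦ by
      rw [he, MeasurableEquiv.piFinSuccAbove_symm_apply]
      simp [Fin.insertNthEquiv]
    have hcons : Measurable fun p : E × (Fin n → E) ↦ (Fin.cons p.1 p.2 : Fin (n + 1) → E) := by
      have := e.symm.measurable
      rwa [show ⇑e.symm = _ from funext hsymm] at this
    set w : E × (Fin n → E) → ℝ := fun p ↦ u (Fin.cons p.1 p.2) with hw
    have hwm : Measurable w := hu.comp hcons
    have hupd : ∀ i : Fin (n + 1), Measurable (Function.uncurry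
        fun (x : Fin (n + 1) → E) t ↦ u (Function.update x i t)) :=
      fun i ↦ hu.comp measurable_update'
    have hent : ∀ i, Integrable (fun x ↦ entropy μ (fun t ↦ u (Function.update x i t)))
        (Measure.pi fun _ ↦ μ) := fun i ↦ integrable_of_abs_le
      (measurable_entropy_left μ (hupd i)) fun x ↦ abs_entropy_le μ fun y ↦ habs _
    have hprod := entropy_prod_le μ (Measure.pi fun _ : Fin n ↦ μ) hwm hc (fun p ↦ hcu _)
      (fun p ↦ huC _)
    have hleft : entropy (Measure.pi fun _ ↦ μ) u =
        entropy (μ.prod (Measure.pi fun _ : Fin n ↦ μ)) w := by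
      simp only [entropy, hint, hsymm, hw]
    rw [hleft, Fin.sum_univ_succ]
    refine hprod.trans (add_le_add (le_of_eq ?_) ?_)
    · rw [hint, integral_prod_symm]
      · simp only [hsymm, Fin.update_cons_zero]
        simp [hw]
      · exact (hmp.integrable_comp_emb e.symm.measurableEmbedding).2 (hent 0)
    · have hent' : ∀ i : Fin n, Integrable
          (fun p : E × (Fin n → E) ↦ entropy μ (fun t ↦ w (p.1, Function.update p.2 i t)))
          (μ.prod (Measure.pi fun _ ↦ μ)) := fun i ↦ by
        have := (hmp.integrable_comp_emb e.symm.measurableEmbedding).2 (hent i.succ)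
        simpa only [Function.comp_def, hsymm, ← Fin.cons_update] using this
      have hterm : ∀ i : Fin n, ∫ x, entropy μ (fun t ↦ u (Function.update x i.succ t))
          ∂(Measure.pi fun _ ↦ μ) = ∫ x, ∫ y, entropy μ (fun t ↦ w (x, Function.update y i t))
            ∂(Measure.pi fun _ ↦ μ) ∂μ := fun i ↦ by
        rw [← integral_prod _ (hent' i), hint]
        simp only [hsymm, ← Fin.cons_update, hw]
      simp only [hterm]
      rw [← integral_finsetSum _ fun i _ ↦ (hent' i).integral_prod_left]
      refine integral_mono (integrable_of_abs_le (measurable_entropy_left _ hwm)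
        fun x ↦ abs_entropy_le _ fun y ↦ habs _)
        (integrable_finsetSum _ fun i _ ↦ (hent' i).integral_prod_left) fun x ↦ ?_
      exact entropy_pi_le μ hc n (hwm.comp measurable_prodMk_left) (fun _ ↦ hcu _)
        (fun _ ↦ huC _)


section

open Filter Topology

lemma exists_inverse_of_deriv_ge {G G' : ℝ → ℝ} {c : ℝ} (hc : 0 < c)
    (hd : ∀ x, HasDerivAt G (G' x) x) (hG' : ∀ x, c ≤ G' x) :
    ∃ S : ℝ → ℝ, (∀ y, G (S y) = y) ∧ (∀ x, S (G x) = x) ∧ Monotone S ∧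
      ∀ y, HasDerivAt S (G' (S y))⁻¹ y := by
  have hmono : StrictMono G := strictMono_of_deriv_pos fun x ↦ by
    rw [(hd x).deriv]; exact hc.trans_le (hG' x)
  have hcont : Continuous G := continuous_iff_continuousAt.2 fun x ↦ (hd x).continuousAt
  have hsub : Monotone fun x ↦ G x - c * x := by
    have h : ∀ x, HasDerivAt (fun x ↦ G x - c * x) (G' x - c) x := fun x ↦ by
      refine ((hd x).sub ((hasDerivAt_id x).const_mul c)).congr_deriv ?_
      ring
    refine monotone_of_deriv_nonneg (fun x ↦ (h x).differentiableAt) fun x ↦ ?_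
    rw [(h x).deriv]
    linarith [hG' x]
  have htop : Tendsto G atTop atTop := by
    refine tendsto_atTop_mono' _ ?_
      (tendsto_atTop_add_const_left _ (G 0) (tendsto_id.const_mul_atTop hc))
    filter_upwards [eventually_ge_atTop 0] with x hx
    have := hsub hx
    simp only [id] at *
    linarith
  have hbot : Tendsto G atBot atBot := by
    refine tendsto_atBot_mono' _ ?_
      (tendsto_atBot_add_const_left _ (G 0) (tendsto_id.const_mul_atBot hc))
    filter_upwards [eventually_le_atBot 0] with x hx
    have := hsub hx
    simp only [id] at *
    linarith
  have hsurj := hcont.surjective htop hbot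
  set e := hmono.orderIsoOfSurjective G hsurj with he
  have hGe : ∀ y, G (e.symm y) = y := fun y ↦ e.apply_symm_apply y
  refine ⟨e.symm, hGe, fun x ↦ e.symm_apply_apply x, e.symm.monotone, fun y ↦ ?_⟩
  exact HasDerivAt.of_local_left_inverse e.symm.continuous.continuousAt (hd _)
    (hc.trans_le (hG' _)).ne' (.of_forall hGe)

/-- The increasing transport map between two densities on an interval. -/
lemma exists_monotone_transport {a b : ℝ} (hab : a < b) {p q : ℝ → ℝ} (hp : Continuous p)
    (hq : Continuous q) (hp0 : ∀ x ∈ Icc a b, 0 < p x) {c : ℝ} (hc : 0 < c)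
    (hcq : ∀ x, c ≤ q x) :
    ∃ T T' : ℝ → ℝ, T a = a ∧ T b = b ∧ (∀ x ∈ Icc a b, T x ∈ Icc a b) ∧ Continuous T' ∧
      (∀ x, HasDerivAt T (T' x) x) ∧
      ∀ x, T' x * q (T x) * (∫ y in a..b, p y) = (∫ y in a..b, q y) * p x := by
  set A := ∫ y in a..b, p y with hA
  set Z := ∫ y in a..b, q y with hZ
  have hA0 : 0 < A := intervalIntegral.intervalIntegral_pos_of_pos_on
    (hp.intervalIntegrable _ _) (fun x hx ↦ hp0 x ⟨hx.1.le, hx.2.le⟩) hab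
  have hZ0 : 0 < Z := intervalIntegral.intervalIntegral_pos_of_pos_on
    (hq.intervalIntegrable _ _) (fun x _ ↦ hc.trans_le (hcq x)) hab
  have hG : ∀ x, HasDerivAt (fun x ↦ (∫ y in a..x, q y) / Z) (q x / Z) x := fun x ↦
    (intervalIntegral.integral_hasDerivAt_right (hq.intervalIntegrable _ _)
      (hq.stronglyMeasurableAtFilter _ _) hq.continuousAt).div_const Z
  have hH : ∀ x, HasDerivAt (fun x ↦ (∫ y in a..x, p y) / A) (p x / A) x := fun x ↦
    (intervalIntegral.integral_hasDerivAt_right (hp.intervalIntegrable _ _)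
      (hp.stronglyMeasurableAtFilter _ _) hp.continuousAt).div_const A
  obtain ⟨S, -, hSG, hSm, hSd⟩ := exists_inverse_of_deriv_ge (c := c / Z) (by positivity) hG
    fun x ↦ by gcongr; exact hcq x
  have hTd := fun x ↦ (hSd _).comp x (hH x)
  set T : ℝ → ℝ := fun x ↦ S ((∫ y in a..x, p y) / A) with hT
  have hTa : T a = a := by
    have := hSG a
    simpa [hT] using this
  have hTb : T b = b := by
    have := hSG b
    rw [← hZ, div_self hZ0.ne'] at this
    simpa [hT, ← hA, div_self hA0.ne'] using this
  have hHm : MonotoneOn (fun x ↦ (∫ y in a..x, p y) / A) (Icc a b) := by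
    refine monotoneOn_of_deriv_nonneg (convex_Icc a b)
      (fun x _ ↦ (hH x).continuousAt.continuousWithinAt)
      (fun x _ ↦ (hH x).differentiableAt.differentiableWithinAt) fun x hx ↦ ?_
    rw [(hH x).deriv]
    exact div_nonneg (hp0 x (interior_subset hx)).le hA0.le
  have hTc : Continuous T := continuous_iff_continuousAt.2 fun x ↦ (hTd x).continuousAt
  refine ⟨T, fun x ↦ (q (T x) / Z)⁻¹ * (p x / A), hTa, hTb, fun x hx ↦ ⟨?_, ?_⟩, ?_, hTd,
    fun x ↦ ?_⟩
  · rw [← hTa]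
    exact hSm (hHm (left_mem_Icc.2 hab.le) hx hx.1)
  · rw [← hTb]
    exact hSm (hHm hx (right_mem_Icc.2 hab.le) hx.2)
  · refine (((hq.comp hTc).div_const Z).inv₀ fun x ↦ ?_).mul (hp.div_const A)
    exact (div_pos (hc.trans_le (hcq _)) hZ0).ne'
  · have := (hc.trans_le (hcq (T x))).ne'
    field_simp

/-- The logarithmic Sobolev inequality for the Gaussian density restricted to an interval, proved
by transport of mass. -/
lemma interval_gaussian_logSobolev {K σ : ℝ} (hK : 0 < K) (hσ : 0 < σ) {f f' : ℝ → ℝ}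
    (hf : ∀ x, HasDerivAt f (f' x) x) (hf' : Continuous f') (hpos : ∀ x ∈ Icc (-K) K, 0 < f x) :
    (∫ x in (-K)..K, f x * Real.log (f x) * Real.exp (-x ^ 2 / (2 * σ ^ 2))) -
      (∫ x in (-K)..K, f x * Real.exp (-x ^ 2 / (2 * σ ^ 2))) *
        Real.log ((∫ x in (-K)..K, f x * Real.exp (-x ^ 2 / (2 * σ ^ 2))) /
          ∫ x in (-K)..K, Real.exp (-x ^ 2 / (2 * σ ^ 2))) ≤
      σ ^ 2 / 2 * ∫ x in (-K)..K, f' x ^ 2 / f x * Real.exp (-x ^ 2 / (2 * σ ^ 2)) := by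
  have hfc : Continuous f := continuous_iff_continuousAt.2 fun x ↦ (hf x).continuousAt
  have hKK : -K < K := by linarith
  set φ : ℝ → ℝ := fun x ↦ Real.exp (-x ^ 2 / (2 * σ ^ 2)) with hφ
  have hφc : Continuous φ := by fun_prop
  have hφd : ∀ x, HasDerivAt φ (-(x / σ ^ 2) * φ x) x := fun x ↦ by
    refine (((hasDerivAt_pow 2 x).neg.div_const (2 * σ ^ 2)).exp).congr_deriv ?_
    simp only [hφ, Pi.neg_apply]
    field_simp
    norm_num
    ring
  obtain ⟨T, T', hTa, hTb, hTm, hT'c, hTd, hTeq⟩ := exists_monotone_transport hKK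
    (p := fun x ↦ f x * φ x) (q := fun x ↦ Real.exp (-(min (x ^ 2) (K ^ 2)) / (2 * σ ^ 2)))
    (by fun_prop) (by fun_prop) (fun x hx ↦ mul_pos (hpos x hx) (Real.exp_pos _))
    (Real.exp_pos (-K ^ 2 / (2 * σ ^ 2))) (fun x ↦ by gcongr; exact min_le_right _ _)
  have hTc : Continuous T := continuous_iff_continuousAt.2 fun x ↦ (hTd x).continuousAt
  have hqφ : ∀ x ∈ Icc (-K) K, Real.exp (-(min (x ^ 2) (K ^ 2)) / (2 * σ ^ 2)) = φ x :=
    fun x hx ↦ by rw [min_eq_left (sq_le_sq' hx.1 hx.2)]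
  have hZeq : ∫ y in (-K)..K, Real.exp (-(min (y ^ 2) (K ^ 2)) / (2 * σ ^ 2)) =
      ∫ y in (-K)..K, φ y := intervalIntegral.integral_congr fun x hx ↦ by
    rw [uIcc_of_le hKK.le] at hx
    exact hqφ x hx
  rw [hZeq] at hTeq
  set A := ∫ y in (-K)..K, f y * φ y with hA
  set Z := ∫ y in (-K)..K, φ y with hZ
  have hA0 : 0 < A := intervalIntegral.intervalIntegral_pos_of_pos_on
    ((hfc.mul hφc).intervalIntegrable _ _)
    (fun x hx ↦ mul_pos (hpos x ⟨hx.1.le, hx.2.le⟩) (Real.exp_pos _)) hKK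
  have hZ0 : 0 < Z := intervalIntegral.intervalIntegral_pos_of_pos_on
    (hφc.intervalIntegrable _ _) (fun x _ ↦ Real.exp_pos _) hKK
  set D : ℝ → ℝ := fun x ↦ f' x * (T x - x) * φ x + f x * (T' x - 1) * φ x
    - f x * (T x - x) * (x / σ ^ 2) * φ x with hD
  have hDc : Continuous D := by fun_prop
  have hDint : ∫ x in (-K)..K, D x = 0 := by
    rw [intervalIntegral.integral_eq_sub_of_hasDerivAt
      (f := fun x ↦ f x * (T x - x) * φ x) (fun x _ ↦ ?_) (hDc.intervalIntegrable _ _)]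
    · simp [hTa, hTb]
    · refine (((hf x).mul ((hTd x).sub (hasDerivAt_id x))).mul (hφd x)).congr_deriv ?_
      simp only [hD, Pi.mul_apply, Pi.sub_apply, id]
      ring
  have hquot : ContinuousOn (fun x ↦ f' x ^ 2 / f x * φ x) (uIcc (-K) K) := by
    rw [uIcc_of_le hKK.le]
    exact ((hf'.pow 2).continuousOn.div hfc.continuousOn fun x hx ↦ (hpos x hx).ne').mul
      hφc.continuousOn
  have hlogc : Continuous fun x ↦ f x * Real.log (f x) * φ x :=
    (Real.continuous_mul_log.comp hfc).mul hφc
  have hpt : ∀ x ∈ Icc (-K) K, f x * Real.log (f x) * φ x - Real.log (A / Z) * (f x * φ x) ≤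
      D x + σ ^ 2 / 2 * (f' x ^ 2 / f x * φ x) := by
    intro x hx
    have hfx := hpos x hx
    have hT'eq : T' x = (f x / (A / Z)) * (φ x / φ (T x)) := by
      have h := hTeq x
      rw [hqφ _ (hTm x hx)] at h
      have : φ (T x) ≠ 0 := (Real.exp_pos _).ne'
      field_simp
      linarith
    have hAZ : 0 < A / Z := div_pos hA0 hZ0
    have hφx : 0 < φ x := Real.exp_pos _
    have hφT : 0 < φ (T x) := Real.exp_pos _
    have hT'0 : 0 < T' x := by rw [hT'eq]; positivity
    have hlog := Real.log_le_sub_one_of_pos hT'0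
    rw [hT'eq, Real.log_mul (by positivity) (by positivity), Real.log_div hfx.ne' hAZ.ne',
      Real.log_div hφx.ne' hφT.ne', ← hT'eq] at hlog
    simp only [hφ, Real.log_exp] at hlog
    have h1 : Real.log (f x) - Real.log (A / Z) ≤
        (T' x - 1) - (T x - x) * (x / σ ^ 2) - (T x - x) ^ 2 / (2 * σ ^ 2) := by
      have : -x ^ 2 / (2 * σ ^ 2) - -T x ^ 2 / (2 * σ ^ 2) =
          (T x - x) * (x / σ ^ 2) + (T x - x) ^ 2 / (2 * σ ^ 2) := by
        field_simp
        ring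
      linarith
    have h2 : -(f x * ((T x - x) ^ 2 / (2 * σ ^ 2))) ≤
        f' x * (T x - x) + σ ^ 2 / 2 * (f' x ^ 2 / f x) := by
      have : f' x * (T x - x) + σ ^ 2 / 2 * (f' x ^ 2 / f x) +
          f x * ((T x - x) ^ 2 / (2 * σ ^ 2)) =
          (f x * (T x - x) + σ ^ 2 * f' x) ^ 2 / (2 * σ ^ 2 * f x) := by
        field_simp
        ring
      have : 0 ≤ (f x * (T x - x) + σ ^ 2 * f' x) ^ 2 / (2 * σ ^ 2 * f x) := by positivity
      linarith
    have h3 := mul_le_mul_of_nonneg_left h1 hfx.le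
    have h4 : f x * Real.log (f x) - Real.log (A / Z) * f x ≤ f' x * (T x - x) +
        f x * (T' x - 1) - f x * (T x - x) * (x / σ ^ 2) + σ ^ 2 / 2 * (f' x ^ 2 / f x) := by
      linarith
    have h5 := mul_le_mul_of_nonneg_right h4 hφx.le
    simp only [hD]
    linarith
  have hi1 : IntervalIntegrable (fun x ↦ Real.log (A / Z) * (f x * φ x)) volume (-K) K :=
    ((hfc.mul hφc).const_mul _).intervalIntegrable _ _
  have hi2 : IntervalIntegrable (fun x ↦ σ ^ 2 / 2 * (f' x ^ 2 / f x * φ x)) volume (-K) K :=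
    hquot.intervalIntegrable.const_mul _
  have hint := intervalIntegral.integral_mono_on hKK.le
    ((hlogc.intervalIntegrable _ _).sub hi1) ((hDc.intervalIntegrable _ _).add hi2) hpt
  rw [intervalIntegral.integral_sub (hlogc.intervalIntegrable _ _) hi1,
    intervalIntegral.integral_add (hDc.intervalIntegrable _ _) hi2, hDint,
    intervalIntegral.integral_const_mul, intervalIntegral.integral_const_mul, ← hA] at hint
  linarith


open ProbabilityTheory

/-- The centred Gaussian measure of variance `σ ^ 2` conditioned to the interval `[-K, K]`. -/
noncomputable def truncGaussian (σ K : ℝ) : Measure ℝ :=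
  ProbabilityTheory.cond (gaussianReal 0 (Real.toNNReal (σ ^ 2))) (Icc (-K) K)

lemma integral_Icc_gaussianReal {σ K : ℝ} (hσ : 0 < σ) (hK : 0 < K) (g : ℝ → ℝ) :
    ∫ x in Icc (-K) K, g x ∂(gaussianReal 0 (Real.toNNReal (σ ^ 2))) =
      (√(2 * π * σ ^ 2))⁻¹ * ∫ x in (-K)..K, g x * Real.exp (-x ^ 2 / (2 * σ ^ 2)) := by
  have hv : Real.toNNReal (σ ^ 2) ≠ 0 := (Real.toNNReal_pos.2 (by positivity)).ne'
  rw [← integral_indicator measurableSet_Icc, integral_gaussianReal_eq_integral_smul hv,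
    intervalIntegral.integral_of_le (by linarith), ← integral_Icc_eq_integral_Ioc,
    ← integral_const_mul, ← integral_indicator measurableSet_Icc]
  refine integral_congr_ae (.of_forall fun x ↦ ?_)
  by_cases hx : x ∈ Icc (-K) K
  · simp only [indicator_of_mem hx, smul_eq_mul, gaussianPDFReal, Real.coe_toNNReal _ (sq_nonneg σ),
      sub_zero]
    ring
  · simp [indicator_of_notMem hx]

lemma gaussianReal_Icc_pos {σ K : ℝ} (hσ : 0 < σ) (hK : 0 < K) :
    0 < (gaussianReal 0 (Real.toNNReal (σ ^ 2))).real (Icc (-K) K) := by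
  have h := integral_Icc_gaussianReal hσ hK (fun _ ↦ 1)
  simp only [integral_const, smul_eq_mul, mul_one, one_mul, measureReal_restrict_apply_univ] at h
  rw [h]
  refine mul_pos (by positivity) ?_
  exact intervalIntegral.intervalIntegral_pos_of_pos
    ((by fun_prop : Continuous fun x : ℝ ↦ Real.exp (-x ^ 2 / (2 * σ ^ 2))).intervalIntegrable _ _)
    (fun x ↦ Real.exp_pos _) (by linarith)

lemma isProbabilityMeasure_truncGaussian {σ K : ℝ} (hσ : 0 < σ) (hK : 0 < K) :
    IsProbabilityMeasure (truncGaussian σ K) := by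
  rw [truncGaussian]
  refine cond_isProbabilityMeasure fun h ↦ ?_
  have := gaussianReal_Icc_pos hσ hK
  simp [measureReal_def, h] at this

lemma integral_truncGaussian {σ K : ℝ} (hσ : 0 < σ) (hK : 0 < K) (g : ℝ → ℝ) :
    ∫ x, g x ∂(truncGaussian σ K) =
      (∫ x in (-K)..K, g x * Real.exp (-x ^ 2 / (2 * σ ^ 2))) /
        ∫ x in (-K)..K, Real.exp (-x ^ 2 / (2 * σ ^ 2)) := by
  have h1 := integral_Icc_gaussianReal hσ hK (fun _ ↦ 1)
  simp only [integral_const, smul_eq_mul, mul_one, one_mul, measureReal_restrict_apply_univ] at h1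
  have hp := gaussianReal_Icc_pos hσ hK
  have hs : 0 < (√(2 * π * σ ^ 2))⁻¹ := by positivity
  rw [truncGaussian, ProbabilityTheory.cond, integral_smul_measure, integral_Icc_gaussianReal hσ hK,
    ENNReal.toReal_inv, ← measureReal_def, h1, smul_eq_mul, mul_inv, div_eq_mul_inv]
  field_simp

lemma ae_mem_truncGaussian (σ K : ℝ) : ∀ᵐ x ∂(truncGaussian σ K), x ∈ Icc (-K) K :=
  ae_cond_mem measurableSet_Icc

lemma entropy_truncGaussian_le {K σ : ℝ} (hK : 0 < K) (hσ : 0 < σ) {f f' : ℝ → ℝ}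
    (hf : ∀ x, HasDerivAt f (f' x) x) (hf' : Continuous f') (hpos : ∀ x ∈ Icc (-K) K, 0 < f x) :
    entropy (truncGaussian σ K) f ≤ σ ^ 2 / 2 * ∫ x, f' x ^ 2 / f x ∂(truncGaussian σ K) := by
  have h := interval_gaussian_logSobolev hK hσ hf hf' hpos
  have hZ : 0 < ∫ x in (-K)..K, Real.exp (-x ^ 2 / (2 * σ ^ 2)) :=
    intervalIntegral.intervalIntegral_pos_of_pos
      ((by fun_prop : Continuous fun x : ℝ ↦ Real.exp (-x ^ 2 / (2 * σ ^ 2))).intervalIntegrable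
        _ _)
      (fun x ↦ Real.exp_pos _) (by linarith)
  simp only [entropy, integral_truncGaussian hσ hK]
  rw [← mul_div_assoc, div_mul_eq_mul_div, ← sub_div, div_le_div_iff_of_pos_right hZ]
  exact h

lemma map_update_prod_pi {E : Type*} [MeasurableSpace E] (μ : Measure E) [IsProbabilityMeasure μ]
    {n : ℕ} (i : Fin n) :
    ((Measure.pi fun _ : Fin n ↦ μ).prod μ).map (fun p ↦ Function.update p.1 i p.2) =
      Measure.pi fun _ ↦ μ := by
  symm
  refine Measure.pi_eq fun s hs ↦ ?_
  have hm : Measurable fun p : (Fin n → E) × E ↦ Function.update p.1 i p.2 := measurable_update'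
  rw [Measure.map_apply hm (MeasurableSet.univ_pi hs)]
  have : (fun p : (Fin n → E) × E ↦ Function.update p.1 i p.2) ⁻¹' univ.pi s =
      (univ.pi (Function.update s i univ)) ×ˢ s i := by
    ext p
    simp only [mem_preimage, mem_univ_pi, mem_prod]
    constructor
    · intro h
      refine ⟨fun j ↦ ?_, by simpa using h i⟩
      by_cases hj : j = i
      · subst hj; simp
      · simpa [hj] using h j
    · rintro ⟨h1, h2⟩ j
      by_cases hj : j = i
      · subst hj; simpa using h2
      · simpa [hj] using h1 j
  rw [this, Measure.prod_prod, Measure.pi_pi, ← Finset.prod_erase_mul _ _ (Finset.mem_univ i),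
    ← Finset.prod_erase_mul _ (fun j ↦ μ (s j)) (Finset.mem_univ i)]
  simp only [Function.update_self, measure_univ, mul_one]
  congr 1
  refine Finset.prod_congr rfl fun j hj ↦ ?_
  rw [Function.update_of_ne (Finset.ne_of_mem_erase hj)]

lemma ae_mem_pi_truncGaussian {σ K : ℝ} (hσ : 0 < σ) (hK : 0 < K) (n : ℕ) :
    ∀ᵐ x ∂(Measure.pi fun _ : Fin n ↦ truncGaussian σ K), x ∈ univ.pi fun _ ↦ Icc (-K) K := by
  have := isProbabilityMeasure_truncGaussian hσ hK
  simp only [mem_univ_pi]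
  rw [ae_all_iff]
  intro i
  exact (measurePreserving_eval (fun _ : Fin n ↦ truncGaussian σ K) i).quasiMeasurePreserving.ae
    (ae_mem_truncGaussian σ K)


lemma integrable_pi_truncGaussian {σ K : ℝ} (hσ : 0 < σ) (hK : 0 < K) {n : ℕ}
    {f : (Fin n → ℝ) → ℝ} (hf : Measurable f)
    (hc : ContinuousOn f (univ.pi fun _ ↦ Icc (-K) K)) :
    Integrable f (Measure.pi fun _ ↦ truncGaussian σ K) := by
  have := isProbabilityMeasure_truncGaussian hσ hK
  obtain ⟨M, hM⟩ := (isCompact_univ_pi fun _ : Fin n ↦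
    isCompact_Icc (a := -K) (b := K)).exists_bound_of_continuousOn hc
  exact Integrable.of_bound hf.aestronglyMeasurable M
    ((ae_mem_pi_truncGaussian hσ hK n).mono fun x hx ↦ hM x hx)

/-- The squared Euclidean norm of the differential of `W` at `x`. -/
noncomputable def gradSq {n : ℕ} (W : (Fin n → ℝ) → ℝ) (x : Fin n → ℝ) : ℝ :=
  ∑ i, fderiv ℝ W x (Pi.single i 1) ^ 2

lemma gradSq_nonneg {n : ℕ} (W : (Fin n → ℝ) → ℝ) (x : Fin n → ℝ) : 0 ≤ gradSq W x :=
  Finset.sum_nonneg fun _ _ ↦ sq_nonneg _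

lemma continuous_gradSq {n : ℕ} {W : (Fin n → ℝ) → ℝ} (hW : ContDiff ℝ 1 W) :
    Continuous (gradSq W) :=
  continuous_finsetSum _ fun _ _ ↦
    ((hW.continuous_fderiv one_ne_zero).clm_apply continuous_const).pow 2

lemma gradSq_of_hasFDerivAt_smul {n : ℕ} {V W : (Fin n → ℝ) → ℝ} {x : Fin n → ℝ} {a : ℝ}
    (h : HasFDerivAt V (a • fderiv ℝ W x) x) : gradSq V x = a ^ 2 * gradSq W x := by
  simp only [gradSq, h.fderiv, Finset.mul_sum, _root_.smul_apply, smul_eq_mul, mul_pow]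

lemma entropy_congr_ae {α : Type*} [MeasurableSpace α] {μ : Measure α} {u v : α → ℝ}
    (h : u =ᵐ[μ] v) : entropy μ u = entropy μ v := by
  rw [entropy, entropy, integral_congr_ae h,
    integral_congr_ae (h.mono fun x (hx : u x = v x) ↦
      show u x * Real.log (u x) = v x * Real.log (v x) by rw [hx])]

lemma entropy_pi_truncGaussian_le {K σ : ℝ} (hK : 0 < K) (hσ : 0 < σ) {n : ℕ}
    {W : (Fin n → ℝ) → ℝ} (hW : ContDiff ℝ 1 W)
    (hpos : ∀ x ∈ univ.pi fun _ : Fin n ↦ Icc (-K) K, 0 < W x) :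
    entropy (Measure.pi fun _ ↦ truncGaussian σ K) W ≤
      σ ^ 2 / 2 * ∫ x, gradSq W x / W x ∂(Measure.pi fun _ ↦ truncGaussian σ K) := by
  have := isProbabilityMeasure_truncGaussian hσ hK
  set Q : Set (Fin n → ℝ) := univ.pi fun _ ↦ Icc (-K) K with hQ
  have hQc : IsCompact Q := isCompact_univ_pi fun _ ↦ isCompact_Icc
  have hQne : Q.Nonempty := ⟨0, by rw [hQ, mem_univ_pi]; simp [hK.le]⟩
  obtain ⟨a, haQ, ha⟩ := hQc.exists_isMinOn hQne hW.continuous.continuousOn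
  obtain ⟨b, hbQ, hb⟩ := hQc.exists_isMaxOn hQne hW.continuous.continuousOn
  have hc : 0 < W a := hpos a haQ
  have hab : W a ≤ W b := ha hbQ
  set u : (Fin n → ℝ) → ℝ := fun x ↦ max (W a) (min (W x) (W b)) with hu
  have huW : ∀ x ∈ Q, u x = W x := fun x hx ↦ by
    rw [hu]
    simp only
    rw [min_eq_left (hb hx), max_eq_right (ha hx)]
  have hucont : Continuous u := continuous_const.max (hW.continuous.min continuous_const)
  have hum : Measurable u := hucont.measurable
  have huc : ∀ x, W a ≤ u x := fun x ↦ le_max_left _ _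
  have huC : ∀ x, u x ≤ W b := fun x ↦ max_le hab (min_le_right _ _)
  have huabs : ∀ x, |u x| ≤ W b := fun x ↦
    abs_le.2 ⟨by linarith [huc x, huC x], huC x⟩
  have haeQ := ae_mem_pi_truncGaussian hσ hK n
  have hupd : ∀ x ∈ Q, ∀ i, ∀ t ∈ Icc (-K) K, Function.update x i t ∈ Q := by
    intro x hx i t ht
    simp only [hQ, mem_univ_pi] at hx ⊢
    intro j
    by_cases hj : j = i
    · subst hj; simpa using ht
    · simpa [hj] using hx j
  rw [entropy_congr_ae (v := u) (haeQ.mono fun x hx ↦ (huW x hx).symm)]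
  refine (entropy_pi_le _ hc n hum huc huC).trans ?_
  set ψ : Fin n → (Fin n → ℝ) → ℝ := fun i x ↦ fderiv ℝ W x (Pi.single i 1) ^ 2 / W x with hψ
  have hdc : ∀ i, Continuous fun x ↦ fderiv ℝ W x (Pi.single i (1 : ℝ)) := fun i ↦
    (hW.continuous_fderiv one_ne_zero).clm_apply continuous_const
  have hψm : ∀ i, Measurable (ψ i) := fun i ↦
    ((hdc i).measurable.pow_const 2).div hW.continuous.measurable
  have hψi : ∀ i, Integrable (ψ i) (Measure.pi fun _ ↦ truncGaussian σ K) := fun i ↦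
    integrable_pi_truncGaussian hσ hK (hψm i)
      (((hdc i).pow 2).continuousOn.div hW.continuous.continuousOn fun x hx ↦ (hpos x hx).ne')
  have hsum : ∫ x, gradSq W x / W x ∂(Measure.pi fun _ ↦ truncGaussian σ K) =
      ∑ i, ∫ x, ψ i x ∂(Measure.pi fun _ ↦ truncGaussian σ K) := by
    rw [← integral_finsetSum _ fun i _ ↦ hψi i]
    simp only [gradSq, hψ, Finset.sum_div]
  rw [hsum, Finset.mul_sum]
  refine Finset.sum_le_sum fun i _ ↦ ?_
  have hmu : Measurable fun p : (Fin n → ℝ) × ℝ ↦ Function.update p.1 i p.2 := measurable_update'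
  have hmap := map_update_prod_pi (truncGaussian σ K) i
  have hψp : Integrable (fun p : (Fin n → ℝ) × ℝ ↦ ψ i (Function.update p.1 i p.2))
      ((Measure.pi fun _ ↦ truncGaussian σ K).prod (truncGaussian σ K)) := by
    have h := hψi i
    rw [← hmap] at h
    exact h.comp_measurable hmu
  have hψint : ∫ x, ψ i x ∂(Measure.pi fun _ ↦ truncGaussian σ K) =
      ∫ x, ∫ t, ψ i (Function.update x i t) ∂(truncGaussian σ K)
        ∂(Measure.pi fun _ ↦ truncGaussian σ K) := by
    conv_lhs => rw [← hmap]
    rw [integral_map hmu.aemeasurable (hψm i).aestronglyMeasurable, integral_prod _ hψp]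
  rw [hψint, ← integral_const_mul]
  refine integral_mono_ae ?_ (hψp.integral_prod_left.const_mul _) ?_
  · refine integrable_of_abs_le (M := 2 * (1 + W b ^ 2)) ?_ fun x ↦
      abs_entropy_le _ fun t ↦ huabs _
    exact measurable_entropy_left _ (hum.comp hmu)
  · filter_upwards [haeQ] with x hx
    rw [entropy_congr_ae (v := fun t ↦ W (Function.update x i t))
      ((ae_mem_truncGaussian σ K).mono fun t ht ↦ huW _ (hupd x hx i t ht))]
    refine entropy_truncGaussian_le (f' := fun t ↦ fderiv ℝ W (Function.update x i t)
      (Pi.single i 1)) hK hσ (fun t ↦ ?_) ?_ fun t ht ↦ hpos _ (hupd x hx i t ht)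
    · exact ((hW.differentiable one_ne_zero).differentiableAt.hasFDerivAt).comp_hasDerivAt t
        (hasDerivAt_update x i t)
    · exact (hdc i).comp (continuous_const.update i continuous_id)


lemma entropy_sq_pi_truncGaussian_le {K σ : ℝ} (hK : 0 < K) (hσ : 0 < σ) {n : ℕ}
    {H : (Fin n → ℝ) → ℝ} (hH : ContDiff ℝ 1 H) :
    entropy (Measure.pi fun _ ↦ truncGaussian σ K) (fun x ↦ H x ^ 2) ≤
      2 * σ ^ 2 * ∫ x, gradSq H x ∂(Measure.pi fun _ ↦ truncGaussian σ K) := by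
  have := isProbabilityMeasure_truncGaussian hσ hK
  have hint : ∀ {f : (Fin n → ℝ) → ℝ}, Continuous f →
      Integrable f (Measure.pi fun _ ↦ truncGaussian σ K) := fun hf ↦
    integrable_pi_truncGaussian hσ hK hf.measurable hf.continuousOn
  have hHc := hH.continuous
  have hle : ∀ δ : ℝ, 0 < δ →
      entropy (Measure.pi fun _ ↦ truncGaussian σ K) (fun x ↦ H x ^ 2 + δ) ≤
      2 * σ ^ 2 * ∫ x, gradSq H x ∂(Measure.pi fun _ ↦ truncGaussian σ K) := by
    intro δ hδ
    have hW : ContDiff ℝ 1 fun x ↦ H x ^ 2 + δ := (hH.pow 2).add contDiff_const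
    have hWp : ∀ x, 0 < H x ^ 2 + δ := fun x ↦ by positivity
    have h := entropy_pi_truncGaussian_le hK hσ hW fun x _ ↦ hWp x
    refine h.trans ?_
    have hg : ∀ x, gradSq (fun x ↦ H x ^ 2 + δ) x = (2 * H x) ^ 2 * gradSq H x := fun x ↦ by
      apply gradSq_of_hasFDerivAt_smul
      have := ((hH.differentiable one_ne_zero).differentiableAt (x := x)).hasFDerivAt.pow 2
      simpa using this.add_const δ
    have hmono : ∫ x, gradSq (fun x ↦ H x ^ 2 + δ) x / (H x ^ 2 + δ)
        ∂(Measure.pi fun _ ↦ truncGaussian σ K) ≤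
        ∫ x, 4 * gradSq H x ∂(Measure.pi fun _ ↦ truncGaussian σ K) := by
      refine integral_mono (hint ?_) (hint ?_) fun x ↦ ?_
      · exact (continuous_gradSq hW).div hW.continuous fun x ↦ (hWp x).ne'
      · exact continuous_const.mul (continuous_gradSq hH)
      · simp only
        rw [hg, div_le_iff₀ (hWp x)]
        nlinarith [mul_nonneg hδ.le (gradSq_nonneg H x)]
    rw [integral_const_mul] at hmono
    have := mul_le_mul_of_nonneg_left hmono (by positivity : 0 ≤ σ ^ 2 / 2)
    linarith
  have hcont : Tendsto (fun δ : ℝ ↦ entropy (Measure.pi fun _ ↦ truncGaussian σ K)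
      (fun x ↦ H x ^ 2 + δ)) (𝓝[>] 0)
      (𝓝 (entropy (Measure.pi fun _ ↦ truncGaussian σ K) (fun x ↦ H x ^ 2))) := by
    have h1 : Tendsto (fun δ : ℝ ↦ ∫ x, (H x ^ 2 + δ) * Real.log (H x ^ 2 + δ)
        ∂(Measure.pi fun _ ↦ truncGaussian σ K)) (𝓝[>] 0)
        (𝓝 (∫ x, H x ^ 2 * Real.log (H x ^ 2) ∂(Measure.pi fun _ ↦ truncGaussian σ K))) := by
      refine tendsto_integral_filter_of_dominated_convergence (fun x ↦ 1 + (H x ^ 2 + 1) ^ 2)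
        (.of_forall fun δ ↦ ?_) ?_ (hint (by fun_prop)) (.of_forall fun x ↦ ?_)
      · exact (Real.continuous_mul_log.comp ((hHc.pow 2).add
          continuous_const)).aestronglyMeasurable
      · filter_upwards [Ioo_mem_nhdsGT (zero_lt_one' ℝ)] with δ hδ
        refine .of_forall fun x ↦ (abs_mul_log_le _).trans ?_
        have : 0 ≤ H x ^ 2 := sq_nonneg _
        nlinarith [hδ.1, hδ.2]
      · have : Tendsto (fun δ : ℝ ↦ H x ^ 2 + δ) (𝓝[>] 0) (𝓝 (H x ^ 2 + 0)) :=
          ((continuous_const.add continuous_id).tendsto 0).mono_left nhdsWithin_le_nhds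
        rw [add_zero] at this
        exact (Real.continuous_mul_log.tendsto _).comp this
    have h2 : Tendsto (fun δ : ℝ ↦ ∫ x, (H x ^ 2 + δ)
        ∂(Measure.pi fun _ ↦ truncGaussian σ K)) (𝓝[>] 0)
        (𝓝 (∫ x, H x ^ 2 ∂(Measure.pi fun _ ↦ truncGaussian σ K))) := by
      have : ∀ δ : ℝ, ∫ x, (H x ^ 2 + δ) ∂(Measure.pi fun _ ↦ truncGaussian σ K) =
          ∫ x, H x ^ 2 ∂(Measure.pi fun _ ↦ truncGaussian σ K) + δ := fun δ ↦ by
        rw [integral_add (hint (f := fun x ↦ H x ^ 2) (hHc.pow 2)) (integrable_const _)]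
        simp
      simp only [this]
      have h3 : Tendsto (fun δ : ℝ ↦ (∫ x, H x ^ 2 ∂(Measure.pi fun _ ↦ truncGaussian σ K)) + δ)
          (𝓝[>] 0) (𝓝 ((∫ x, H x ^ 2 ∂(Measure.pi fun _ ↦ truncGaussian σ K)) + 0)) :=
        ((continuous_const.add continuous_id).tendsto 0).mono_left nhdsWithin_le_nhds
      rwa [add_zero] at h3
    exact h1.sub ((Real.continuous_mul_log.tendsto _).comp h2)
  exact le_of_tendsto hcont (eventually_mem_nhdsWithin.mono fun δ hδ ↦ hle δ hδ)

lemma add_sq_div_le_mul_log {x a : ℝ} (hx : -1 < x) (hxa : |x| ≤ a) :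
    x + x ^ 2 / (2 + a) ≤ (1 + x) * Real.log (1 + x) := by
  rcases le_total 0 x with h0 | h0
  · have h := mul_le_mul_of_nonneg_left (Real.le_log_one_add_of_nonneg h0)
      (by linarith : 0 ≤ 1 + x)
    refine le_trans ?_ h
    have : (1 + x) * (2 * x / (x + 2)) = x + x ^ 2 / (2 + x) := by
      field_simp
      ring
    rw [this]
    have : x ≤ a := (le_abs_self x).trans hxa
    gcongr
  · have ht : 0 < 1 + x := by linarith
    have ha : 0 ≤ a := (abs_nonneg x).trans hxa
    have h1 : 0 ≤ Real.log (1 + x)⁻¹ := Real.log_nonneg ((one_le_inv₀ ht).2 (by linarith))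
    have h2 := Real.self_le_sinh_iff.2 h1
    rw [Real.sinh_log (by positivity), Real.log_inv, inv_inv] at h2
    have h3 := mul_le_mul_of_nonneg_left h2 ht.le
    have h4 : (1 + x) * (((1 + x)⁻¹ - (1 + x)) / 2) = (1 - (1 + x) ^ 2) / 2 := by
      field_simp
    have h5 : x ^ 2 / (2 + a) ≤ x ^ 2 / 2 := by
      gcongr
      linarith
    nlinarith

lemma variance_pi_truncGaussian_le {K σ : ℝ} (hK : 0 < K) (hσ : 0 < σ) {n : ℕ}
    {u : (Fin n → ℝ) → ℝ} (hu : ContDiff ℝ 1 u) :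
    (∫ x, u x ^ 2 ∂(Measure.pi fun _ ↦ truncGaussian σ K)) -
      (∫ x, u x ∂(Measure.pi fun _ ↦ truncGaussian σ K)) ^ 2 ≤
      σ ^ 2 * ∫ x, gradSq u x ∂(Measure.pi fun _ ↦ truncGaussian σ K) := by
  have := isProbabilityMeasure_truncGaussian hσ hK
  have hint : ∀ {f : (Fin n → ℝ) → ℝ}, Continuous f →
      Integrable f (Measure.pi fun _ ↦ truncGaussian σ K) := fun hf ↦
    integrable_pi_truncGaussian hσ hK hf.measurable hf.continuousOn
  have huc := hu.continuous
  set P := (Measure.pi fun _ : Fin n ↦ truncGaussian σ K) with hP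
  set Q : Set (Fin n → ℝ) := univ.pi fun _ ↦ Icc (-K) K with hQ
  set m := ∫ x, u x ∂P with hm
  set U : (Fin n → ℝ) → ℝ := fun x ↦ u x - m with hU
  have hUc : Continuous U := huc.sub continuous_const
  have hUint : ∫ x, U x ∂P = 0 := by
    rw [hU, integral_sub (hint huc) (integrable_const _)]
    simp [hm]
  have hvar : (∫ x, u x ^ 2 ∂P) - m ^ 2 = ∫ x, U x ^ 2 ∂P := by
    have : ∀ x, u x ^ 2 = U x ^ 2 + 2 * m * U x + m ^ 2 := fun x ↦ by
      simp only [hU]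
      ring
    simp only [this]
    rw [integral_add (hint (f := fun x ↦ U x ^ 2 + 2 * m * U x) (by fun_prop))
        (integrable_const _),
      integral_add (hint (f := fun x ↦ U x ^ 2) (hUc.pow 2)) ((hint hUc).const_mul _),
      integral_const_mul, hUint]
    simp
  rw [hvar]
  obtain ⟨M, hM⟩ := (isCompact_univ_pi fun _ : Fin n ↦
    isCompact_Icc (a := -K) (b := K)).exists_bound_of_continuousOn hUc.continuousOn
  have hM' : ∀ x ∈ Q, |U x| ≤ |M| := fun x hx ↦ (hM x hx).trans (le_abs_self M)
  have haeQ : ∀ᵐ x ∂P, x ∈ Q := ae_mem_pi_truncGaussian hσ hK n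
  have hle : ∀ δ : ℝ, 0 < δ → δ * |M| < 1 → (1 - δ * |M|) * ∫ x, U x ^ 2 ∂P ≤
      σ ^ 2 / 2 * (2 + δ * |M|) * ∫ x, gradSq u x ∂P := by
    intro δ hδ hδM
    have hx1 : ∀ x ∈ Q, |δ * U x| ≤ δ * |M| := fun x hx ↦ by
      rw [abs_mul, abs_of_pos hδ]
      exact mul_le_mul_of_nonneg_left (hM' x hx) hδ.le
    have hWlow : ∀ x ∈ Q, 1 - δ * |M| ≤ 1 + δ * U x := fun x hx ↦ by
      linarith [(abs_le.1 (hx1 x hx)).1]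
    have hW : ContDiff ℝ 1 fun x ↦ 1 + δ * U x :=
      contDiff_const.add (contDiff_const.mul (hu.sub contDiff_const))
    have hWpos : ∀ x ∈ Q, 0 < 1 + δ * U x := fun x hx ↦ by linarith [hWlow x hx]
    have h := entropy_pi_truncGaussian_le hK hσ hW hWpos
    rw [← hP] at h
    have hmean : ∫ x, (1 + δ * U x) ∂P = 1 := by
      rw [integral_add (integrable_const _) ((hint hUc).const_mul _), integral_const_mul, hUint]
      simp
    rw [entropy, hmean, Real.log_one, mul_zero, sub_zero] at h
    have hg : ∀ x, gradSq (fun x ↦ 1 + δ * U x) x = δ ^ 2 * gradSq u x := fun x ↦ by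
      apply gradSq_of_hasFDerivAt_smul
      have := ((hu.differentiable one_ne_zero).differentiableAt (x := x)).hasFDerivAt
      simpa [hU] using ((this.sub_const m).const_mul δ).const_add 1
    have hl : ∫ x, (δ * U x + (δ * U x) ^ 2 / (2 + δ * |M|)) ∂P ≤
        ∫ x, (1 + δ * U x) * Real.log (1 + δ * U x) ∂P := by
      refine integral_mono_ae (hint (by fun_prop)) (hint ?_) (haeQ.mono fun x hx ↦ ?_)
      · exact Real.continuous_mul_log.comp hW.continuous
      · exact add_sq_div_le_mul_log (by linarith [hWpos x hx]) (hx1 x hx)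
    have hl' : ∫ x, (δ * U x + (δ * U x) ^ 2 / (2 + δ * |M|)) ∂P =
        δ ^ 2 / (2 + δ * |M|) * ∫ x, U x ^ 2 ∂P := by
      have : ∀ x, δ * U x + (δ * U x) ^ 2 / (2 + δ * |M|) =
        δ * U x + δ ^ 2 / (2 + δ * |M|) * U x ^ 2 := fun x ↦ by ring
      simp only [this]
      rw [integral_add ((hint hUc).const_mul _)
          ((hint (f := fun x ↦ U x ^ 2) (hUc.pow 2)).const_mul _),
        integral_const_mul, integral_const_mul, hUint]
      simp
    have hr : ∫ x, gradSq (fun x ↦ 1 + δ * U x) x / (1 + δ * U x) ∂P ≤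
        ∫ x, δ ^ 2 / (1 - δ * |M|) * gradSq u x ∂P := by
      refine integral_mono_ae (integrable_pi_truncGaussian hσ hK ?_ ?_)
        (hint (continuous_const.mul (continuous_gradSq hu))) (haeQ.mono fun x hx ↦ ?_)
      · exact (continuous_gradSq hW).measurable.div hW.continuous.measurable
      · exact (continuous_gradSq hW).continuousOn.div hW.continuous.continuousOn
          fun x hx ↦ (hWpos x hx).ne'
      · simp only
        rw [hg, div_mul_eq_mul_div]
        exact div_le_div_of_nonneg_left (mul_nonneg (sq_nonneg _) (gradSq_nonneg _ _))
          (by linarith) (hWlow x hx)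
    rw [integral_const_mul] at hr
    rw [hl'] at hl
    have h6 := hl.trans (h.trans (mul_le_mul_of_nonneg_left hr (by positivity)))
    have hp1 : 0 < 1 - δ * |M| := by linarith
    have hp2 : 0 < 2 + δ * |M| := by positivity
    have h7 := mul_le_mul_of_nonneg_left h6
      (by positivity : 0 ≤ (1 - δ * |M|) * (2 + δ * |M|) / δ ^ 2)
    have e1 : (1 - δ * |M|) * (2 + δ * |M|) / δ ^ 2 * (δ ^ 2 / (2 + δ * |M|) * ∫ x, U x ^ 2 ∂P) =
        (1 - δ * |M|) * ∫ x, U x ^ 2 ∂P := by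
      field_simp
    have e2 : (1 - δ * |M|) * (2 + δ * |M|) / δ ^ 2 *
        (σ ^ 2 / 2 * (δ ^ 2 / (1 - δ * |M|) * ∫ x, gradSq u x ∂P)) =
        σ ^ 2 / 2 * (2 + δ * |M|) * ∫ x, gradSq u x ∂P := by
      field_simp
    rwa [e1, e2] at h7
  have t0 : Tendsto (fun δ : ℝ ↦ δ * |M|) (𝓝[>] 0) (𝓝 0) := by
    have : Tendsto (fun δ : ℝ ↦ δ * |M|) (𝓝[>] 0) (𝓝 (0 * |M|)) :=
      ((continuous_id.mul continuous_const).tendsto 0).mono_left nhdsWithin_le_nhds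
    rwa [zero_mul] at this
  have t1 : Tendsto (fun δ : ℝ ↦ (1 - δ * |M|) * ∫ x, U x ^ 2 ∂P) (𝓝[>] 0)
      (𝓝 ((1 - 0) * ∫ x, U x ^ 2 ∂P)) := (tendsto_const_nhds.sub t0).mul_const _
  have t2 : Tendsto (fun δ : ℝ ↦ σ ^ 2 / 2 * (2 + δ * |M|) * ∫ x, gradSq u x ∂P) (𝓝[>] 0)
      (𝓝 (σ ^ 2 / 2 * (2 + 0) * ∫ x, gradSq u x ∂P)) :=
    ((tendsto_const_nhds.add t0).const_mul _).mul_const _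
  have hfin := le_of_tendsto_of_tendsto t1 t2 (by
    filter_upwards [t0.eventually (gt_mem_nhds one_pos), self_mem_nhdsWithin] with δ h1 h2
    exact hle δ h2 h1)
  linarith


lemma pi_truncGaussian_eq_cond {σ K : ℝ} (n : ℕ) :
    (Measure.pi fun _ : Fin n ↦ truncGaussian σ K) =
      ProbabilityTheory.cond (Measure.pi fun _ ↦ gaussianReal 0 (Real.toNNReal (σ ^ 2)))
        (univ.pi fun _ ↦ Icc (-K) K) := by
  have : IsFiniteMeasure (truncGaussian σ K) := by
    unfold truncGaussian
    infer_instance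
  refine Measure.pi_eq fun s hs ↦ ?_
  rw [cond_apply (MeasurableSet.univ_pi fun _ ↦ measurableSet_Icc), ← pi_inter_distrib,
    Measure.pi_pi, Measure.pi_pi, ENNReal.prod_inv_distrib, ← Finset.prod_mul_distrib]
  · simp only [truncGaussian, cond_apply measurableSet_Icc]
  · exact fun _ _ _ _ _ ↦ .inr (measure_ne_top _ _)

lemma tendsto_integral_pi_truncGaussian {σ : ℝ} {n : ℕ} {g : (Fin n → ℝ) → ℝ}
    (hg : Integrable g (Measure.pi fun _ ↦ gaussianReal 0 (Real.toNNReal (σ ^ 2)))) :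
    Tendsto (fun k : ℕ ↦ ∫ x, g x ∂(Measure.pi fun _ ↦ truncGaussian σ (k + 1))) atTop
      (𝓝 (∫ x, g x ∂(Measure.pi fun _ ↦ gaussianReal 0 (Real.toNNReal (σ ^ 2))))) := by
  set P := Measure.pi fun _ : Fin n ↦ gaussianReal 0 (Real.toNNReal (σ ^ 2))
  set Q : ℕ → Set (Fin n → ℝ) := fun k ↦ univ.pi fun _ ↦ Icc (-(k + 1 : ℝ)) (k + 1) with hQ
  have hQm : ∀ k, MeasurableSet (Q k) := fun k ↦ MeasurableSet.univ_pi fun _ ↦ measurableSet_Icc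
  have hmono : Monotone Q := fun j k hjk ↦ by
    have : (j : ℝ) ≤ k := by exact_mod_cast hjk
    exact pi_mono fun _ _ ↦ Icc_subset_Icc (by linarith) (by linarith)
  have hU : ⋃ k, Q k = univ := by
    refine eq_univ_of_forall fun x ↦ mem_iUnion.2 ?_
    obtain ⟨k, hk⟩ := exists_nat_ge ‖x‖
    refine ⟨k, mem_univ_pi.2 fun i ↦ ?_⟩
    have := abs_le.1 ((norm_le_pi_norm x i).trans hk)
    exact ⟨by linarith [this.1], by linarith [this.2]⟩
  have key : ∀ {f : (Fin n → ℝ) → ℝ}, Integrable f P →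
      Tendsto (fun k ↦ ∫ x in Q k, f x ∂P) atTop (𝓝 (∫ x, f x ∂P)) := fun {f} hf ↦ by
    have h := tendsto_setIntegral_of_monotone hQm hmono (f := f) (μ := P) hf.integrableOn
    rwa [hU, setIntegral_univ] at h
  have h1 := key (integrable_const (1 : ℝ))
  simp only [integral_const, smul_eq_mul, mul_one, measureReal_restrict_apply_univ,
    probReal_univ] at h1
  have h2 := (h1.inv₀ one_ne_zero).mul (key hg)
  simp only [inv_one, one_mul] at h2
  refine h2.congr fun k ↦ ?_
  rw [pi_truncGaussian_eq_cond, ProbabilityTheory.cond, integral_smul_measure,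
    ENNReal.toReal_inv, ← measureReal_def, smul_eq_mul]

lemma entropy_sq_pi_gaussianReal_le {σ : ℝ} (hσ : 0 < σ) {n : ℕ} {H : (Fin n → ℝ) → ℝ}
    (hH : ContDiff ℝ 1 H) {P : Measure (Fin n → ℝ)}
    (hP : P = Measure.pi fun _ ↦ gaussianReal 0 (Real.toNNReal (σ ^ 2)))
    (h1 : Integrable (fun x ↦ H x ^ 2) P)
    (h2 : Integrable (fun x ↦ H x ^ 2 * Real.log (H x ^ 2)) P)
    (h3 : Integrable (gradSq H) P) :
    entropy P (fun x ↦ H x ^ 2) ≤ 2 * σ ^ 2 * ∫ x, gradSq H x ∂P := by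
  subst hP
  exact le_of_tendsto_of_tendsto' ((tendsto_integral_pi_truncGaussian h2).sub
    ((Real.continuous_mul_log.tendsto _).comp (tendsto_integral_pi_truncGaussian h1)))
    ((tendsto_integral_pi_truncGaussian h3).const_mul _)
    fun k ↦ entropy_sq_pi_truncGaussian_le (by positivity) hσ hH

lemma variance_pi_gaussianReal_le {σ : ℝ} (hσ : 0 < σ) {n : ℕ} {u : (Fin n → ℝ) → ℝ}
    (hu : ContDiff ℝ 1 u) {P : Measure (Fin n → ℝ)}
    (hP : P = Measure.pi fun _ ↦ gaussianReal 0 (Real.toNNReal (σ ^ 2)))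
    (h1 : Integrable u P) (h2 : Integrable (fun x ↦ u x ^ 2) P) (h3 : Integrable (gradSq u) P) :
    (∫ x, u x ^ 2 ∂P) - (∫ x, u x ∂P) ^ 2 ≤ σ ^ 2 * ∫ x, gradSq u x ∂P := by
  subst hP
  exact le_of_tendsto_of_tendsto' ((tendsto_integral_pi_truncGaussian h2).sub
    ((tendsto_integral_pi_truncGaussian h1).pow 2))
    ((tendsto_integral_pi_truncGaussian h3).const_mul _)
    fun k ↦ variance_pi_truncGaussian_le (by positivity) hσ hu

lemma measurePreserving_toLp_gaussMeasure {n : ℕ} {σ : ℝ} (hσ : 0 < σ) :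
    MeasurePreserving (WithLp.toLp 2 : (Fin n → ℝ) → En n)
      (Measure.pi fun _ ↦ gaussianReal 0 (Real.toNNReal (σ ^ 2))) (gaussMeasure n σ) := by
  have hv : Real.toNNReal (σ ^ 2) ≠ 0 := (Real.toNNReal_pos.2 (by positivity)).ne'
  set p : ℝ → ℝ := gaussianPDFReal 0 (Real.toNNReal (σ ^ 2)) with hp
  have hpi : (Measure.pi fun _ : Fin n ↦ gaussianReal 0 (Real.toNNReal (σ ^ 2))) =
      volume.withDensity fun x ↦ ENNReal.ofReal (∏ i, p (x i)) := by
    refine Measure.pi_eq fun s hs ↦ ?_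
    rw [withDensity_apply _ (MeasurableSet.univ_pi hs), volume_pi, Measure.restrict_pi_pi,
      ← ofReal_integral_eq_lintegral_ofReal, integral_fintype_prod_eq_prod (fun _ ↦ p),
      ENNReal.ofReal_prod_of_nonneg]
    · exact Finset.prod_congr rfl fun i _ ↦ (gaussianReal_apply_eq_integral 0 hv (s i)).symm
    · exact fun i _ ↦ integral_nonneg fun x ↦ gaussianPDFReal_nonneg _ _ _
    · exact Integrable.fintype_prod (f := fun _ ↦ p) fun i ↦
        (integrable_gaussianPDFReal _ _).restrict
    · exact .of_forall fun x ↦ Finset.prod_nonneg fun i _ ↦ gaussianPDFReal_nonneg _ _ _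
  have hm : Measurable (WithLp.toLp 2 : (Fin n → ℝ) → En n) :=
    (PiLp.volume_preserving_toLp (Fin n)).measurable
  refine ⟨hm, ?_⟩
  ext s hs
  rw [Measure.map_apply hm hs, hpi, withDensity_apply _ (hm hs), gaussMeasure,
    withDensity_apply _ hs, ← (PiLp.volume_preserving_toLp (Fin n)).setLIntegral_comp_preimage hs]
  · refine lintegral_congr fun x ↦ ?_
    congr 1
    rw [EuclideanSpace.norm_sq_eq]
    simp only [hp, gaussianPDFReal, Real.coe_toNNReal _ (sq_nonneg σ), sub_zero,
      Finset.prod_mul_distrib, Finset.prod_const, Finset.card_univ, Fintype.card_fin,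
      Real.norm_eq_abs, sq_abs, ← Real.exp_sum]
    congr 1
    · rw [Real.sqrt_eq_rpow, ← Real.rpow_neg (by positivity), ← Real.rpow_natCast,
        ← Real.rpow_mul (by positivity)]
      congr 1
      ring
    · rw [← Finset.sum_div, Finset.sum_neg_distrib]
  · fun_prop

lemma isProbabilityMeasure_gaussMeasure {n : ℕ} {σ : ℝ} (hσ : 0 < σ) :
    IsProbabilityMeasure (gaussMeasure n σ) := by
  have h := measurePreserving_toLp_gaussMeasure (n := n) hσ
  rw [← h.map_eq]
  exact Measure.isProbabilityMeasure_map h.measurable.aemeasurable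

lemma gradSq_comp_toLp {n : ℕ} {H : En n → ℝ} (hH : ContDiff ℝ 1 H) (x : Fin n → ℝ) :
    gradSq (H ∘ WithLp.toLp 2) x = ‖gradient H (WithLp.toLp 2 x)‖ ^ 2 := by
  rw [EuclideanSpace.norm_sq_eq, gradSq]
  refine Finset.sum_congr rfl fun i _ ↦ ?_
  rw [Real.norm_eq_abs, sq_abs]
  congr 1
  have h1 := ((hH.differentiable one_ne_zero) (WithLp.toLp 2 x)).hasFDerivAt
  have h2 := (PiLp.continuousLinearEquiv 2 ℝ fun _ : Fin n ↦ ℝ).symm.hasFDerivAt (x := x)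
  have h3 : HasFDerivAt (H ∘ WithLp.toLp 2) _ x := HasFDerivAt.comp x h1 h2
  rw [h3.fderiv]
  have h4 : gradient H (WithLp.toLp 2 x) i =
      ⟪gradient H (WithLp.toLp 2 x), EuclideanSpace.single i (1 : ℝ)⟫ := by
    rw [EuclideanSpace.inner_single_right]
    simp
  rw [h4, gradient, InnerProductSpace.toDual_symm_apply]
  rfl

lemma continuous_norm_gradient_sq {n : ℕ} {H : En n → ℝ} (hH : ContDiff ℝ 1 H) :
    Continuous fun x ↦ ‖gradient H x‖ ^ 2 := by
  simp only [gradient, LinearIsometryEquiv.norm_map]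
  exact (hH.continuous_fderiv one_ne_zero).norm.pow 2

/-- **Gross' logarithmic Sobolev inequality** for `gaussMeasure`. -/
lemma entropy_sq_gaussMeasure_le {σ : ℝ} (hσ : 0 < σ) {n : ℕ} {H : En n → ℝ}
    (hH : ContDiff ℝ 1 H) (h1 : Integrable (fun x ↦ H x ^ 2) (gaussMeasure n σ))
    (h2 : Integrable (fun x ↦ H x ^ 2 * Real.log (H x ^ 2)) (gaussMeasure n σ))
    (h3 : Integrable (fun x ↦ ‖gradient H x‖ ^ 2) (gaussMeasure n σ)) :
    entropy (gaussMeasure n σ) (fun x ↦ H x ^ 2) ≤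
      2 * σ ^ 2 * ∫ x, ‖gradient H x‖ ^ 2 ∂(gaussMeasure n σ) := by
  have hmp := measurePreserving_toLp_gaussMeasure (n := n) hσ
  have hemb : MeasurableEmbedding (WithLp.toLp 2 : (Fin n → ℝ) → En n) :=
    (MeasurableEquiv.toLp 2 (Fin n → ℝ)).measurableEmbedding
  have hHp : ContDiff ℝ 1 (H ∘ WithLp.toLp 2) := hH.comp (by fun_prop)
  simp only [entropy, ← hmp.integral_comp hemb]
  have h := entropy_sq_pi_gaussianReal_le hσ hHp rfl ((hmp.integrable_comp_emb hemb).2 h1)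
    ((hmp.integrable_comp_emb hemb).2 h2)
    (((hmp.integrable_comp_emb hemb).2 h3).congr (.of_forall fun x ↦ (gradSq_comp_toLp hH x).symm))
  simpa only [entropy, gradSq_comp_toLp hH, Function.comp_apply] using h

/-- The Poincaré inequality for `gaussMeasure`. -/
lemma variance_gaussMeasure_le {σ : ℝ} (hσ : 0 < σ) {n : ℕ} {u : En n → ℝ}
    (hu : ContDiff ℝ 1 u) (h1 : Integrable u (gaussMeasure n σ))
    (h2 : Integrable (fun x ↦ u x ^ 2) (gaussMeasure n σ))
    (h3 : Integrable (fun x ↦ ‖gradient u x‖ ^ 2) (gaussMeasure n σ)) :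
    (∫ x, u x ^ 2 ∂(gaussMeasure n σ)) - (∫ x, u x ∂(gaussMeasure n σ)) ^ 2 ≤
      σ ^ 2 * ∫ x, ‖gradient u x‖ ^ 2 ∂(gaussMeasure n σ) := by
  have hmp := measurePreserving_toLp_gaussMeasure (n := n) hσ
  have hemb : MeasurableEmbedding (WithLp.toLp 2 : (Fin n → ℝ) → En n) :=
    (MeasurableEquiv.toLp 2 (Fin n → ℝ)).measurableEmbedding
  have hup : ContDiff ℝ 1 (u ∘ WithLp.toLp 2) := hu.comp (by fun_prop)
  simp only [← hmp.integral_comp hemb]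
  have h := variance_pi_gaussianReal_le hσ hup rfl ((hmp.integrable_comp_emb hemb).2 h1)
    ((hmp.integrable_comp_emb hemb).2 h2)
    (((hmp.integrable_comp_emb hemb).2 h3).congr (.of_forall fun x ↦ (gradSq_comp_toLp hu x).symm))
  simpa only [gradSq_comp_toLp hu, Function.comp_apply] using h


lemma ae_norm_le_of_measSupport_subset {n : ℕ} {ν : Measure (En n)} {R : ℝ}
    (hsupp : measSupport ν ⊆ Metric.closedBall (0 : En n) R) : ∀ᵐ y ∂ν, ‖y‖ ≤ R := by
  refine measure_null_of_locally_null _ fun x hx ↦ ?_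
  have hx' : x ∉ measSupport ν := fun h ↦ hx (by simpa using hsupp h)
  simp only [measSupport, Set.mem_ofPred_eq, not_forall, not_lt, nonpos_iff_eq_zero] at hx'
  obtain ⟨U, hU, hU0⟩ := hx'
  exact ⟨U, mem_nhdsWithin_of_mem_nhds hU, hU0⟩

/-- The density of `gaussMeasure n σ`. -/
noncomputable def gaussDensity {n : ℕ} (σ : ℝ) (x : En n) : ℝ :=
  (2 * π * σ ^ 2) ^ (-(n : ℝ) / 2) * Real.exp (-‖x‖ ^ 2 / (2 * σ ^ 2))

lemma gaussDensity_pos {n : ℕ} {σ : ℝ} (hσ : 0 < σ) (x : En n) : 0 < gaussDensity σ x := by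
  unfold gaussDensity
  positivity

lemma continuous_gaussDensity {n : ℕ} (σ : ℝ) : Continuous (gaussDensity σ : En n → ℝ) := by
  unfold gaussDensity
  fun_prop

lemma gaussMeasure_eq {n : ℕ} (σ : ℝ) :
    gaussMeasure n σ = volume.withDensity fun x ↦ ENNReal.ofReal (gaussDensity σ x) := rfl

lemma lintegral_gaussDensity {n : ℕ} {σ : ℝ} (hσ : 0 < σ) :
    ∫⁻ x : En n, ENNReal.ofReal (gaussDensity σ x) = 1 := by
  have := isProbabilityMeasure_gaussMeasure (n := n) hσ
  have h : gaussMeasure n σ univ = 1 := measure_univ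
  rwa [gaussMeasure_eq, withDensity_apply _ MeasurableSet.univ, Measure.restrict_univ] at h

lemma integrable_gaussDensity {n : ℕ} {σ : ℝ} (hσ : 0 < σ) :
    Integrable (gaussDensity σ : En n → ℝ) := by
  refine ⟨(continuous_gaussDensity σ).aestronglyMeasurable, ?_⟩
  rw [hasFiniteIntegral_iff_ofReal (.of_forall fun x ↦ (gaussDensity_pos hσ x).le),
    lintegral_gaussDensity hσ]
  exact ENNReal.one_lt_top

lemma integral_gaussDensity {n : ℕ} {σ : ℝ} (hσ : 0 < σ) :
    ∫ x : En n, gaussDensity σ x = 1 := by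
  rw [integral_eq_lintegral_of_nonneg_ae (.of_forall fun x ↦ (gaussDensity_pos hσ x).le)
    (continuous_gaussDensity σ).aestronglyMeasurable, lintegral_gaussDensity hσ, ENNReal.toReal_one]

lemma integral_withDensity_ofReal {α : Type*} [MeasurableSpace α] {μ : Measure α} {d : α → ℝ}
    (hd : Measurable d) (hd0 : ∀ x, 0 ≤ d x) (g : α → ℝ) :
    ∫ x, g x ∂(μ.withDensity fun x ↦ ENNReal.ofReal (d x)) = ∫ x, g x * d x ∂μ := by
  rw [integral_withDensity_eq_integral_toReal_smul hd.ennreal_ofReal (by simp)]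
  refine integral_congr_ae (.of_forall fun x ↦ ?_)
  simp [ENNReal.toReal_ofReal (hd0 x), mul_comm]

lemma integrable_withDensity_ofReal {α : Type*} [MeasurableSpace α] {μ : Measure α} {d : α → ℝ}
    (hd : Measurable d) (hd0 : ∀ x, 0 ≤ d x) (g : α → ℝ) :
    Integrable g (μ.withDensity fun x ↦ ENNReal.ofReal (d x)) ↔
      Integrable (fun x ↦ g x * d x) μ := by
  rw [integrable_withDensity_iff hd.ennreal_ofReal (by simp)]
  simp only [ENNReal.toReal_ofReal (hd0 _)]

lemma integrable_gaussMeasure_of_abs_le {n : ℕ} {σ : ℝ} (hσ : 0 < σ) {g : En n → ℝ}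
    (hg : Continuous g) {A B : ℝ} (hgb : ∀ x, |g x| ≤ A * Real.exp (B * ‖x‖)) :
    Integrable g (gaussMeasure n σ) := by
  rw [gaussMeasure_eq, integrable_withDensity_ofReal (continuous_gaussDensity σ).measurable
    fun x ↦ (gaussDensity_pos hσ x).le]
  set c : ℝ := (2 * π * σ ^ 2) ^ (-(n : ℝ) / 2) with hc
  set c' : ℝ := (2 * π * (2 * σ) ^ 2) ^ (-(n : ℝ) / 2) with hc'
  have hcp : 0 < c := by positivity
  have hcp' : 0 < c' := by positivity
  refine ((integrable_gaussDensity (n := n) (by positivity : 0 < 2 * σ)).const_mul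
    (|A| * Real.exp (B ^ 2 * σ ^ 2) * c / c')).mono'
    (hg.mul (continuous_gaussDensity σ)).aestronglyMeasurable (.of_forall fun x ↦ ?_)
  rw [Real.norm_eq_abs, abs_mul, abs_of_pos (gaussDensity_pos hσ x)]
  refine (mul_le_mul_of_nonneg_right (hgb x) (gaussDensity_pos hσ x).le).trans ?_
  simp only [gaussDensity, ← hc, ← hc']
  have e1 : |A| * Real.exp (B ^ 2 * σ ^ 2) * c / c' *
      (c' * Real.exp (-‖x‖ ^ 2 / (2 * (2 * σ) ^ 2))) =
      |A| * c * (Real.exp (B ^ 2 * σ ^ 2) * Real.exp (-‖x‖ ^ 2 / (2 * (2 * σ) ^ 2))) := by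
    field_simp
  have e2 : A * Real.exp (B * ‖x‖) * (c * Real.exp (-‖x‖ ^ 2 / (2 * σ ^ 2))) =
      A * c * (Real.exp (B * ‖x‖) * Real.exp (-‖x‖ ^ 2 / (2 * σ ^ 2))) := by ring
  rw [e1, e2, ← Real.exp_add, ← Real.exp_add]
  gcongr ?_ * _ * Real.exp ?_
  · exact le_abs_self A
  · have : B ^ 2 * σ ^ 2 + -‖x‖ ^ 2 / (2 * (2 * σ) ^ 2) -
        (B * ‖x‖ + -‖x‖ ^ 2 / (2 * σ ^ 2)) =
        (B * σ - ‖x‖ / (2 * σ)) ^ 2 + ‖x‖ ^ 2 / (8 * σ ^ 2) := by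
      field_simp
      ring
    have : 0 ≤ (B * σ - ‖x‖ / (2 * σ)) ^ 2 + ‖x‖ ^ 2 / (8 * σ ^ 2) := by positivity
    linarith

lemma exp_inner_mul_gaussDensity {n : ℕ} {σ : ℝ} (hσ : 0 < σ) (x v : En n) :
    Real.exp ((⟪x, v⟫ - ‖v‖ ^ 2 / 2) / σ ^ 2) * gaussDensity σ x = gaussDensity σ (x - v) := by
  rw [gaussDensity, gaussDensity, norm_sub_sq_real, mul_left_comm, ← Real.exp_add]
  congr 2
  field_simp
  ring

lemma integral_exp_inner_gaussMeasure {n : ℕ} {σ : ℝ} (hσ : 0 < σ) (v : En n) :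
    ∫ x, Real.exp (⟪x, v⟫ / σ ^ 2) ∂(gaussMeasure n σ) = Real.exp (‖v‖ ^ 2 / (2 * σ ^ 2)) := by
  rw [gaussMeasure_eq, integral_withDensity_ofReal (continuous_gaussDensity σ).measurable
    fun x ↦ (gaussDensity_pos hσ x).le]
  have : ∀ x : En n, Real.exp (⟪x, v⟫ / σ ^ 2) * gaussDensity σ x =
      Real.exp (‖v‖ ^ 2 / (2 * σ ^ 2)) * gaussDensity σ (x - v) := fun x ↦ by
    rw [← exp_inner_mul_gaussDensity hσ, ← mul_assoc, ← Real.exp_add]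
    congr 2
    field_simp
    ring
  simp only [this]
  rw [integral_const_mul, integral_sub_right_eq_self (fun x ↦ gaussDensity σ x),
    integral_gaussDensity hσ, mul_one]

/-- The density of the Gaussian mollification of `ν` with respect to `gaussMeasure n σ`. -/
noncomputable def mollDensity {n : ℕ} (ν : Measure (En n)) (σ : ℝ) (x : En n) : ℝ :=
  ∫ y, Real.exp ((⟪x, y⟫ - ‖y‖ ^ 2 / 2) / σ ^ 2) ∂ν

lemma aestronglyMeasurable_deriv_exp_moll {n : ℕ} {ν : Measure (En n)} (σ : ℝ) (x : En n) :
    AEStronglyMeasurable (fun y : En n ↦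
      (Real.exp ((⟪x, y⟫ - ‖y‖ ^ 2 / 2) / σ ^ 2) * (σ ^ 2)⁻¹) • innerSL ℝ y) ν :=
  Continuous.aestronglyMeasurable (by fun_prop)

section Mollification

variable {n : ℕ} {ν : Measure (En n)} [IsProbabilityMeasure ν] {R σ : ℝ}

lemma integrable_exp_moll (hν : ∀ᵐ y ∂ν, ‖y‖ ≤ R) (hσ : 0 < σ) (x : En n) :
    Integrable (fun y ↦ Real.exp ((⟪x, y⟫ - ‖y‖ ^ 2 / 2) / σ ^ 2)) ν := by
  refine Integrable.of_bound (Continuous.aestronglyMeasurable (by fun_prop))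
    (Real.exp (‖x‖ * R / σ ^ 2)) (hν.mono fun y hy ↦ ?_)
  rw [Real.norm_eq_abs, Real.abs_exp]
  gcongr
  have h1 := real_inner_le_norm x y
  have h2 := mul_le_mul_of_nonneg_left hy (norm_nonneg x)
  have : 0 ≤ ‖y‖ ^ 2 := by positivity
  linarith

lemma mconv_gaussMeasure_eq (hν : ∀ᵐ y ∂ν, ‖y‖ ≤ R) (hσ : 0 < σ)
    (hm : Measurable (mollDensity ν σ)) :
    mconv ν (gaussMeasure n σ) =
      (gaussMeasure n σ).withDensity fun x ↦ ENNReal.ofReal (mollDensity ν σ x) := by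
  have := isProbabilityMeasure_gaussMeasure (n := n) hσ
  have hdm : Measurable fun x : En n ↦ ENNReal.ofReal (gaussDensity σ x) :=
    (continuous_gaussDensity σ).measurable.ennreal_ofReal
  rw [gaussMeasure_eq, ← withDensity_mul _ hdm hm.ennreal_ofReal, ← gaussMeasure_eq]
  ext s hs
  have hsi : Measurable (s.indicator (1 : En n → ℝ≥0∞)) := measurable_one.indicator hs
  rw [mconv, ← lintegral_indicator_one hs, lintegral_map hsi (by fun_prop),
    lintegral_prod _ (by fun_prop)]
  have h1 : ∀ y : En n, ∫⁻ z, s.indicator (1 : En n → ℝ≥0∞) (y + z) ∂(gaussMeasure n σ) =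
      ∫⁻ x, ENNReal.ofReal (gaussDensity σ (x - y)) * s.indicator (1 : En n → ℝ≥0∞) x := fun y ↦ by
    rw [gaussMeasure_eq, lintegral_withDensity_eq_lintegral_mul _ hdm (by fun_prop),
      ← lintegral_sub_right_eq_self _ y]
    simp
  simp only [h1]
  rw [lintegral_lintegral_swap]
  · rw [withDensity_apply _ hs, ← lintegral_indicator hs]
    refine lintegral_congr fun x ↦ ?_
    rw [lintegral_mul_const _ (by
      exact ((continuous_gaussDensity σ).comp
        (continuous_const.sub continuous_id)).measurable.ennreal_ofReal)]
    by_cases hx : x ∈ s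
    · simp only [indicator_of_mem hx, Pi.one_apply, mul_one, Pi.mul_apply]
      simp only [← exp_inner_mul_gaussDensity hσ, mul_comm _ (gaussDensity σ x),
        ENNReal.ofReal_mul (gaussDensity_pos hσ x).le]
      rw [lintegral_const_mul _ (by fun_prop), mollDensity,
        ofReal_integral_eq_lintegral_ofReal (integrable_exp_moll hν hσ x)
          (.of_forall fun y ↦ (Real.exp_pos _).le)]
    · simp [indicator_of_notMem hx]
  · refine Measurable.aemeasurable ?_
    refine Measurable.mul ?_ (hsi.comp measurable_snd)
    exact ((continuous_gaussDensity σ).comp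
      (continuous_snd.sub continuous_fst)).measurable.ennreal_ofReal

lemma mollDensity_le (hν : ∀ᵐ y ∂ν, ‖y‖ ≤ R) (hσ : 0 < σ) (x : En n) :
    mollDensity ν σ x ≤ Real.exp (R / σ ^ 2 * ‖x‖) := by
  have h : mollDensity ν σ x ≤ ∫ _, Real.exp (R / σ ^ 2 * ‖x‖) ∂ν := by
    refine integral_mono_ae (integrable_exp_moll hν hσ x) (integrable_const _)
      (hν.mono fun y hy ↦ ?_)
    simp only
    rw [div_mul_eq_mul_div]
    gcongr
    have h1 := real_inner_le_norm x y
    have h2 := mul_le_mul_of_nonneg_left hy (norm_nonneg x)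
    have : 0 ≤ ‖y‖ ^ 2 := by positivity
    linarith
  simpa using h

lemma norm_integral_id_le (hν : ∀ᵐ y ∂ν, ‖y‖ ≤ R) : ‖∫ y, y ∂ν‖ ≤ R := by
  simpa using norm_integral_le_of_norm_le_const hν

lemma exp_le_mollDensity (hν : ∀ᵐ y ∂ν, ‖y‖ ≤ R) (hσ : 0 < σ) (x : En n) :
    Real.exp (⟪x, ∫ y, y ∂ν⟫ / σ ^ 2 - R ^ 2 / (2 * σ ^ 2)) ≤ mollDensity ν σ x := by
  have hid : Integrable (fun y : En n ↦ y) ν :=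
    Integrable.of_bound continuous_id.aestronglyMeasurable R hν
  have hin : Integrable (fun y : En n ↦ ⟪x, y⟫) ν := hid.const_inner x
  set a := ⟪x, ∫ y, y ∂ν⟫ / σ ^ 2 - R ^ 2 / (2 * σ ^ 2) with ha
  have hq' : Integrable (fun y ↦ ⟪x, y⟫ / σ ^ 2 - R ^ 2 / (2 * σ ^ 2)) ν :=
    (hin.div_const _).sub (integrable_const _)
  have hq : Integrable (fun y ↦ ⟪x, y⟫ / σ ^ 2 - R ^ 2 / (2 * σ ^ 2) - a) ν :=
    hq'.sub (integrable_const _)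
  have hlin : ∫ y, (Real.exp a * (1 + (⟪x, y⟫ / σ ^ 2 - R ^ 2 / (2 * σ ^ 2) - a))) ∂ν =
      Real.exp a := by
    rw [integral_const_mul, integral_add (integrable_const _) hq,
      integral_sub hq' (integrable_const _),
      integral_sub (hin.div_const _) (integrable_const _), integral_div, integral_inner hid]
    simp [ha]
  rw [← hlin]
  refine integral_mono_ae ?_ (integrable_exp_moll hν hσ x) (hν.mono fun y hy ↦ ?_)
  · exact ((integrable_const _).add hq).const_mul _
  · have h1 : ⟪x, y⟫ / σ ^ 2 - R ^ 2 / (2 * σ ^ 2) ≤ (⟪x, y⟫ - ‖y‖ ^ 2 / 2) / σ ^ 2 := by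
      have : R ^ 2 / (2 * σ ^ 2) = R ^ 2 / 2 / σ ^ 2 := by field_simp
      rw [this, ← sub_div]
      gcongr
    have h2 := Real.add_one_le_exp (⟪x, y⟫ / σ ^ 2 - R ^ 2 / (2 * σ ^ 2) - a)
    have h3 := mul_le_mul_of_nonneg_left h2 (Real.exp_pos a).le
    rw [← Real.exp_add] at h3
    calc Real.exp a * (1 + (⟪x, y⟫ / σ ^ 2 - R ^ 2 / (2 * σ ^ 2) - a))
        ≤ Real.exp (a + (⟪x, y⟫ / σ ^ 2 - R ^ 2 / (2 * σ ^ 2) - a)) := by linarith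
      _ ≤ _ := Real.exp_le_exp.2 (by linarith)

lemma mollDensity_pos (hν : ∀ᵐ y ∂ν, ‖y‖ ≤ R) (hσ : 0 < σ) (x : En n) :
    0 < mollDensity ν σ x :=
  (Real.exp_pos _).trans_le (exp_le_mollDensity hν hσ x)

lemma hasFDerivAt_exp_moll (σ : ℝ) (x y : En n) :
    HasFDerivAt (fun x : En n ↦ Real.exp ((⟪x, y⟫ - ‖y‖ ^ 2 / 2) / σ ^ 2))
      ((Real.exp ((⟪x, y⟫ - ‖y‖ ^ 2 / 2) / σ ^ 2) * (σ ^ 2)⁻¹) • innerSL ℝ y) x := by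
  have h1 : HasFDerivAt (fun x : En n ↦ ⟪x, y⟫) (innerSL ℝ y) x := by
    have h : (fun x : En n ↦ ⟪x, y⟫) = innerSL ℝ y := funext fun z ↦ real_inner_comm _ _
    rw [h]
    exact (innerSL ℝ y).hasFDerivAt
  have h2 := ((h1.sub_const (‖y‖ ^ 2 / 2)).mul_const (σ ^ 2)⁻¹).exp
  simpa only [div_eq_mul_inv, smul_smul] using h2

lemma norm_deriv_exp_moll_le {x y : En n} (hy : ‖y‖ ≤ R) :
    ‖(Real.exp ((⟪x, y⟫ - ‖y‖ ^ 2 / 2) / σ ^ 2) * (σ ^ 2)⁻¹) • innerSL ℝ y‖ ≤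
      R / σ ^ 2 * Real.exp ((⟪x, y⟫ - ‖y‖ ^ 2 / 2) / σ ^ 2) := by
  rw [norm_smul, innerSL_apply_norm, Real.norm_eq_abs, abs_of_nonneg (by positivity)]
  have := mul_le_mul_of_nonneg_left hy (by positivity :
    0 ≤ Real.exp ((⟪x, y⟫ - ‖y‖ ^ 2 / 2) / σ ^ 2) * (σ ^ 2)⁻¹)
  refine this.trans_eq ?_
  ring

lemma exp_moll_le_of_mem_ball {x₀ x y : En n} (hx : x ∈ Metric.ball x₀ 1)
    (hy : ‖y‖ ≤ R) :
    Real.exp ((⟪x, y⟫ - ‖y‖ ^ 2 / 2) / σ ^ 2) ≤ Real.exp ((‖x₀‖ + 1) * R / σ ^ 2) := by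
  gcongr
  have h1 := real_inner_le_norm x y
  have h2 : ‖x‖ ≤ ‖x₀‖ + 1 := by
    have := norm_sub_norm_le x x₀
    rw [mem_ball_iff_norm] at hx
    linarith
  have h3 := mul_le_mul h2 hy (norm_nonneg y) (by positivity)
  have : 0 ≤ ‖y‖ ^ 2 := by positivity
  linarith

lemma hasFDerivAt_mollDensity (hν : ∀ᵐ y ∂ν, ‖y‖ ≤ R) (hR : 0 ≤ R) (hσ : 0 < σ) (x : En n) :
    HasFDerivAt (mollDensity ν σ)
      (∫ y, (Real.exp ((⟪x, y⟫ - ‖y‖ ^ 2 / 2) / σ ^ 2) * (σ ^ 2)⁻¹) • innerSL ℝ y ∂ν) x := by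
  refine hasFDerivAt_integral_of_dominated_of_fderiv_le
    (bound := fun _ ↦ R / σ ^ 2 * Real.exp ((‖x‖ + 1) * R / σ ^ 2))
    (Metric.ball_mem_nhds x one_pos)
    (.of_forall fun z ↦ (integrable_exp_moll hν hσ z).aestronglyMeasurable)
    (integrable_exp_moll hν hσ x) (aestronglyMeasurable_deriv_exp_moll σ x)
    (hν.mono fun y hy z hz ↦ ?_) (integrable_const _)
    (.of_forall fun y z _ ↦ hasFDerivAt_exp_moll σ z y)
  exact (norm_deriv_exp_moll_le hy).trans
    (mul_le_mul_of_nonneg_left (exp_moll_le_of_mem_ball hz hy) (by positivity))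

lemma contDiff_mollDensity (hν : ∀ᵐ y ∂ν, ‖y‖ ≤ R) (hR : 0 ≤ R) (hσ : 0 < σ) :
    ContDiff ℝ 1 (mollDensity ν σ) := by
  rw [contDiff_one_iff_hasFDerivAt]
  refine ⟨_, continuous_iff_continuousAt.2 fun x ↦ ?_, hasFDerivAt_mollDensity hν hR hσ⟩
  refine continuousAt_of_dominated
    (bound := fun _ ↦ R / σ ^ 2 * Real.exp ((‖x‖ + 1) * R / σ ^ 2))
    (.of_forall fun z ↦ aestronglyMeasurable_deriv_exp_moll σ z) ?_ (integrable_const _)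
    (.of_forall fun y ↦ Continuous.continuousAt (by fun_prop))
  filter_upwards [Metric.ball_mem_nhds x one_pos] with z hz
  exact hν.mono fun y hy ↦ (norm_deriv_exp_moll_le hy).trans
    (mul_le_mul_of_nonneg_left (exp_moll_le_of_mem_ball hz hy) (by positivity))

lemma norm_fderiv_mollDensity_le (hν : ∀ᵐ y ∂ν, ‖y‖ ≤ R) (hR : 0 ≤ R) (hσ : 0 < σ) (x : En n) :
    ‖fderiv ℝ (mollDensity ν σ) x‖ ≤ R / σ ^ 2 * mollDensity ν σ x := by
  rw [(hasFDerivAt_mollDensity hν hR hσ x).fderiv, mollDensity, ← integral_const_mul]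
  exact norm_integral_le_of_norm_le ((integrable_exp_moll hν hσ x).const_mul _)
    (hν.mono fun y hy ↦ norm_deriv_exp_moll_le hy)

end Mollification


lemma integrable_sq_of_abs_le {α : Type*} [MeasurableSpace α] {μ : Measure α} [IsFiniteMeasure μ]
    {f : α → ℝ} {M : ℝ} (hf : Measurable f) (hM : ∀ x, |f x| ≤ M) :
    Integrable (fun x ↦ f x ^ 2) μ :=
  integrable_of_abs_le (M := M ^ 2) (hf.pow_const 2) fun x ↦ by
    rw [abs_pow]
    exact pow_le_pow_left₀ (abs_nonneg _) (hM x) 2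

lemma integral_sub_const_sq {α : Type*} [MeasurableSpace α] {μ : Measure α}
    [IsProbabilityMeasure μ] {f : α → ℝ} {M : ℝ} (hf : Measurable f) (hM : ∀ x, |f x| ≤ M)
    (a : ℝ) :
    ∫ x, (f x - a) ^ 2 ∂μ =
      (∫ x, f x ^ 2 ∂μ) - (∫ x, f x ∂μ) ^ 2 + ((∫ x, f x ∂μ) - a) ^ 2 := by
  have h1 : Integrable f μ := integrable_of_abs_le hf hM
  have h2 := integrable_sq_of_abs_le (μ := μ) hf hM
  have h12 : Integrable (fun x ↦ f x ^ 2 - 2 * a * f x) μ := h2.sub (h1.const_mul _)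
  have e : ∀ x, (f x - a) ^ 2 = f x ^ 2 - 2 * a * f x + a ^ 2 := fun x ↦ by ring
  simp only [e]
  rw [integral_add h12 (integrable_const _), integral_sub h2 (h1.const_mul _),
    integral_const_mul]
  simp
  ring

lemma norm_fderiv_mul_sqrt_le {E : Type*} [NormedAddCommGroup E] [NormedSpace ℝ E] {D g : E → ℝ}
    {b : ℝ} {x : E} (hD : DifferentiableAt ℝ D x) (hD0 : 0 < D x) (hg : DifferentiableAt ℝ g x)
    (hb : ‖fderiv ℝ D x‖ ≤ b * D x) :
    ‖fderiv ℝ (fun y ↦ g y * √(D y)) x‖ ≤ √(D x) * (‖fderiv ℝ g x‖ + b / 2 * |g x|) := by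
  have h := hg.hasFDerivAt.mul (hD.hasFDerivAt.sqrt hD0.ne')
  have hs : 0 < √(D x) := Real.sqrt_pos.2 hD0
  rw [show (fun y ↦ g y * √(D y)) = g * fun y ↦ √(D y) from rfl, h.fderiv]
  refine (norm_add_le _ _).trans ?_
  rw [norm_smul, norm_smul, norm_smul, Real.norm_eq_abs, Real.norm_eq_abs, Real.norm_eq_abs,
    abs_of_pos hs, abs_of_pos (by positivity : 0 < 1 / (2 * √(D x)))]
  have h1 : |g x| * (1 / (2 * √(D x)) * ‖fderiv ℝ D x‖) ≤
      |g x| * (1 / (2 * √(D x)) * (b * D x)) := by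
    gcongr
  have h2 : |g x| * (1 / (2 * √(D x)) * (b * D x)) = √(D x) * (b / 2 * |g x|) := by
    nth_rewrite 2 [← Real.mul_self_sqrt hD0.le]
    field_simp
  linarith

lemma norm_gradient_mul_sqrt_sq_le {n : ℕ} {D g : En n → ℝ} {b t : ℝ} {x : En n}
    (hD : DifferentiableAt ℝ D x) (hD0 : 0 < D x) (hg : DifferentiableAt ℝ g x)
    (hb : ‖fderiv ℝ D x‖ ≤ b * D x) (ht : 0 < t) :
    ‖gradient (fun y ↦ g y * √(D y)) x‖ ^ 2 ≤
      (1 + t⁻¹) * (‖gradient g x‖ ^ 2 * D x) + (1 + t) * b ^ 2 / 4 * (g x ^ 2 * D x) := by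
  simp only [gradient, LinearIsometryEquiv.norm_map]
  refine (pow_le_pow_left₀ (norm_nonneg _) (norm_fderiv_mul_sqrt_le hD hD0 hg hb) 2).trans ?_
  rw [mul_pow, Real.sq_sqrt hD0.le, ← sq_abs (g x)]
  set a := ‖fderiv ℝ g x‖
  set c := |g x|
  have h : (1 + t⁻¹) * (a ^ 2 * D x) + (1 + t) * b ^ 2 / 4 * (c ^ 2 * D x) -
      D x * (a + b / 2 * c) ^ 2 = D x * (t⁻¹ * (a - t * (b / 2 * c)) ^ 2) := by
    field_simp
    ring
  have : 0 ≤ D x * (t⁻¹ * (a - t * (b / 2 * c)) ^ 2) := by positivity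
  linarith

section MollifiedMeasure

variable {n : ℕ} {ν : Measure (En n)} [IsProbabilityMeasure ν] {R σ : ℝ}

lemma isProbabilityMeasure_mconv_gaussMeasure (ν : Measure (En n)) [IsProbabilityMeasure ν]
    (hσ : 0 < σ) : IsProbabilityMeasure (mconv ν (gaussMeasure n σ)) := by
  have := isProbabilityMeasure_gaussMeasure (n := n) hσ
  exact Measure.isProbabilityMeasure_map (by fun_prop)

lemma integral_mconv_gaussMeasure (hν : ∀ᵐ y ∂ν, ‖y‖ ≤ R) (hR : 0 ≤ R) (hσ : 0 < σ)
    (g : En n → ℝ) :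
    ∫ x, g x ∂(mconv ν (gaussMeasure n σ)) = ∫ x, g x * mollDensity ν σ x ∂(gaussMeasure n σ) := by
  have hm := (contDiff_mollDensity hν hR hσ).continuous.measurable
  rw [mconv_gaussMeasure_eq hν hσ hm,
    integral_withDensity_ofReal hm fun x ↦ (mollDensity_pos hν hσ x).le]

lemma integrable_mconv_gaussMeasure_iff (hν : ∀ᵐ y ∂ν, ‖y‖ ≤ R) (hR : 0 ≤ R) (hσ : 0 < σ)
    {g : En n → ℝ} :
    Integrable g (mconv ν (gaussMeasure n σ)) ↔
      Integrable (fun x ↦ g x * mollDensity ν σ x) (gaussMeasure n σ) := by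
  have hm := (contDiff_mollDensity hν hR hσ).continuous.measurable
  rw [mconv_gaussMeasure_eq hν hσ hm,
    integrable_withDensity_ofReal hm fun x ↦ (mollDensity_pos hν hσ x).le]

lemma neg_log_mollDensity_le (hν : ∀ᵐ y ∂ν, ‖y‖ ≤ R) (hσ : 0 < σ) (x : En n) :
    -Real.log (mollDensity ν σ x) ≤ R ^ 2 / (2 * σ ^ 2) - ⟪x, ∫ y, y ∂ν⟫ / σ ^ 2 := by
  have h := Real.log_le_log (Real.exp_pos _) (exp_le_mollDensity hν hσ x)
  rw [Real.log_exp] at h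
  linarith

lemma abs_log_mollDensity_le (hν : ∀ᵐ y ∂ν, ‖y‖ ≤ R) (hσ : 0 < σ) (x : En n) :
    |Real.log (mollDensity ν σ x)| ≤ R / σ ^ 2 * ‖x‖ + R ^ 2 / (2 * σ ^ 2) := by
  have hlow := neg_log_mollDensity_le hν hσ x
  have hup := Real.log_le_log (mollDensity_pos hν hσ x) (mollDensity_le hν hσ x)
  rw [Real.log_exp] at hup
  have hin : -⟪x, ∫ y, y ∂ν⟫ / σ ^ 2 ≤ R / σ ^ 2 * ‖x‖ := by
    rw [div_mul_eq_mul_div]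
    gcongr
    have h1 := (abs_le.1 (abs_real_inner_le_norm x (∫ y, y ∂ν))).1
    have h2 := mul_le_mul_of_nonneg_left (norm_integral_id_le hν) (norm_nonneg x)
    linarith
  rw [neg_div] at hin
  have : 0 ≤ R ^ 2 / (2 * σ ^ 2) := by positivity
  exact abs_le.2 ⟨by linarith, by linarith⟩

lemma integrable_mollDensity (hν : ∀ᵐ y ∂ν, ‖y‖ ≤ R) (hR : 0 ≤ R) (hσ : 0 < σ) :
    Integrable (mollDensity ν σ) (gaussMeasure n σ) :=
  integrable_gaussMeasure_of_abs_le hσ (contDiff_mollDensity hν hR hσ).continuous (A := 1)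
    (B := R / σ ^ 2) fun x ↦ by
      rw [abs_of_pos (mollDensity_pos hν hσ x), one_mul]
      exact mollDensity_le hν hσ x

lemma continuous_log_mollDensity (hν : ∀ᵐ y ∂ν, ‖y‖ ≤ R) (hR : 0 ≤ R) (hσ : 0 < σ) :
    Continuous fun x ↦ Real.log (mollDensity ν σ x) :=
  (contDiff_mollDensity hν hR hσ).continuous.log fun x ↦ (mollDensity_pos hν hσ x).ne'

lemma integrable_log_mollDensity (hν : ∀ᵐ y ∂ν, ‖y‖ ≤ R) (hR : 0 ≤ R) (hσ : 0 < σ) :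
    Integrable (fun x ↦ Real.log (mollDensity ν σ x)) (mconv ν (gaussMeasure n σ)) := by
  rw [integrable_mconv_gaussMeasure_iff hν hR hσ]
  refine integrable_gaussMeasure_of_abs_le hσ ((continuous_log_mollDensity hν hR hσ).mul
    (contDiff_mollDensity hν hR hσ).continuous) (A := Real.exp (R ^ 2 / (2 * σ ^ 2)))
    (B := R / σ ^ 2 + R / σ ^ 2) fun x ↦ ?_
  rw [abs_mul, abs_of_pos (mollDensity_pos hν hσ x), add_mul, Real.exp_add, ← mul_assoc]
  refine mul_le_mul ?_ (mollDensity_le hν hσ x) (mollDensity_pos hν hσ x).le (by positivity)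
  rw [← Real.exp_add]
  have h1 := abs_log_mollDensity_le hν hσ x
  have h2 := Real.add_one_le_exp (R ^ 2 / (2 * σ ^ 2) + R / σ ^ 2 * ‖x‖)
  linarith

lemma integrable_exp_neg_mul_log_mollDensity (hν : ∀ᵐ y ∂ν, ‖y‖ ≤ R) (hR : 0 ≤ R) (hσ : 0 < σ)
    {β : ℝ} (hβ : 0 ≤ β) :
    Integrable (fun x ↦ Real.exp (-(β * Real.log (mollDensity ν σ x)))) (gaussMeasure n σ) := by
  refine integrable_gaussMeasure_of_abs_le hσ
    ((continuous_log_mollDensity hν hR hσ).const_mul β).neg.rexp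
    (A := Real.exp (β * (R ^ 2 / (2 * σ ^ 2)))) (B := β * (R / σ ^ 2)) fun x ↦ ?_
  rw [Real.abs_exp, ← Real.exp_add, Real.exp_le_exp]
  have h1 := (abs_le.1 (abs_log_mollDensity_le hν hσ x)).1
  have := mul_le_mul_of_nonneg_left h1 hβ
  linarith

lemma integral_exp_neg_mul_log_mollDensity_le (hν : ∀ᵐ y ∂ν, ‖y‖ ≤ R) (hR : 0 ≤ R) (hσ : 0 < σ)
    {β : ℝ} (hβ : 0 ≤ β) :
    ∫ x, Real.exp (-(β * Real.log (mollDensity ν σ x))) ∂(gaussMeasure n σ) ≤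
      Real.exp (β * (1 + β) * (R ^ 2 / (2 * σ ^ 2))) := by
  set m := ∫ y, y ∂ν with hm
  have hint : Integrable (fun x ↦ Real.exp (⟪x, -(β • m)⟫ / σ ^ 2)) (gaussMeasure n σ) := by
    refine integrable_gaussMeasure_of_abs_le hσ (by fun_prop) (A := 1) (B := ‖-(β • m)‖ / σ ^ 2)
      fun x ↦ ?_
    rw [Real.abs_exp, one_mul, Real.exp_le_exp, div_mul_eq_mul_div]
    gcongr
    rw [mul_comm]
    exact real_inner_le_norm _ _
  calc ∫ x, Real.exp (-(β * Real.log (mollDensity ν σ x))) ∂(gaussMeasure n σ)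
      ≤ ∫ x, Real.exp (β * (R ^ 2 / (2 * σ ^ 2))) * Real.exp (⟪x, -(β • m)⟫ / σ ^ 2)
          ∂(gaussMeasure n σ) := by
        refine integral_mono (integrable_exp_neg_mul_log_mollDensity hν hR hσ hβ)
          (hint.const_mul _) fun x ↦ ?_
        simp only
        rw [← Real.exp_add, Real.exp_le_exp, inner_neg_right, real_inner_smul_right]
        have := mul_le_mul_of_nonneg_left (neg_log_mollDensity_le hν hσ x) hβ
        have e : -(β * ⟪x, m⟫) / σ ^ 2 = -(β * (⟪x, m⟫ / σ ^ 2)) := by ring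
        rw [e]
        linarith
    _ = Real.exp (β * (R ^ 2 / (2 * σ ^ 2)) + ‖-(β • m)‖ ^ 2 / (2 * σ ^ 2)) := by
        rw [integral_const_mul, integral_exp_inner_gaussMeasure hσ, Real.exp_add]
    _ ≤ _ := by
        rw [Real.exp_le_exp, norm_neg, norm_smul, Real.norm_eq_abs, mul_pow, sq_abs]
        have h1 : β ^ 2 * ‖m‖ ^ 2 / (2 * σ ^ 2) ≤ β ^ 2 * R ^ 2 / (2 * σ ^ 2) := by
          gcongr
          exact norm_integral_id_le hν
        have h2 : β * (1 + β) * (R ^ 2 / (2 * σ ^ 2)) =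
            β * (R ^ 2 / (2 * σ ^ 2)) + β ^ 2 * R ^ 2 / (2 * σ ^ 2) := by ring
        linarith

lemma contDiff_mul_sqrt_mollDensity (hν : ∀ᵐ y ∂ν, ‖y‖ ≤ R) (hR : 0 ≤ R) (hσ : 0 < σ)
    {g : En n → ℝ} (hg : ContDiff ℝ 1 g) : ContDiff ℝ 1 fun x ↦ g x * √(mollDensity ν σ x) :=
  hg.mul ((contDiff_mollDensity hν hR hσ).sqrt fun x ↦ (mollDensity_pos hν hσ x).ne')

lemma mul_sqrt_mollDensity_sq (hν : ∀ᵐ y ∂ν, ‖y‖ ≤ R) (hσ : 0 < σ) (g : En n → ℝ) (x : En n) :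
    (g x * √(mollDensity ν σ x)) ^ 2 = g x ^ 2 * mollDensity ν σ x := by
  rw [mul_pow, Real.sq_sqrt (mollDensity_pos hν hσ x).le]

lemma integrable_sqrt_mollDensity (hν : ∀ᵐ y ∂ν, ‖y‖ ≤ R) (hR : 0 ≤ R) (hσ : 0 < σ) :
    Integrable (fun x ↦ √(mollDensity ν σ x)) (gaussMeasure n σ) := by
  have := isProbabilityMeasure_gaussMeasure (n := n) hσ
  refine ((integrable_const 1).add (integrable_mollDensity hν hR hσ)).mono'
    (contDiff_mollDensity hν hR hσ).continuous.sqrt.aestronglyMeasurable (.of_forall fun x ↦ ?_)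
  rw [Real.norm_eq_abs, abs_of_nonneg (Real.sqrt_nonneg _)]
  have := sq_nonneg (√(mollDensity ν σ x) - 1)
  have h2 := Real.sq_sqrt (mollDensity_pos hν hσ x).le
  have h3 := Real.sqrt_nonneg (mollDensity ν σ x)
  simp only [Pi.add_apply]
  nlinarith

lemma integrable_norm_gradient_mul_sqrt_sq (hν : ∀ᵐ y ∂ν, ‖y‖ ≤ R) (hR : 0 ≤ R) (hσ : 0 < σ)
    {g : En n → ℝ} (hg : ContDiff ℝ 1 g)
    (hg1 : Integrable (fun x ↦ g x ^ 2) (mconv ν (gaussMeasure n σ)))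
    (hg2 : Integrable (fun x ↦ ‖gradient g x‖ ^ 2) (mconv ν (gaussMeasure n σ))) :
    Integrable (fun x ↦ ‖gradient (fun y ↦ g y * √(mollDensity ν σ y)) x‖ ^ 2)
      (gaussMeasure n σ) := by
  rw [integrable_mconv_gaussMeasure_iff hν hR hσ] at hg1 hg2
  refine ((hg2.const_mul (1 + (1 : ℝ)⁻¹)).add
    (hg1.const_mul ((1 + 1) * (R / σ ^ 2) ^ 2 / 4))).mono'
    (continuous_norm_gradient_sq (contDiff_mul_sqrt_mollDensity hν hR hσ hg)).aestronglyMeasurable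
    (.of_forall fun x ↦ ?_)
  rw [Real.norm_eq_abs, abs_of_nonneg (by positivity)]
  exact norm_gradient_mul_sqrt_sq_le ((contDiff_mollDensity hν hR hσ).differentiable one_ne_zero x)
    (mollDensity_pos hν hσ x) (hg.differentiable one_ne_zero x)
    (norm_fderiv_mollDensity_le hν hR hσ x) one_pos

lemma integral_norm_gradient_mul_sqrt_sq_le (hν : ∀ᵐ y ∂ν, ‖y‖ ≤ R) (hR : 0 ≤ R) (hσ : 0 < σ)
    {g : En n → ℝ} (hg : ContDiff ℝ 1 g)
    (hg1 : Integrable (fun x ↦ g x ^ 2) (mconv ν (gaussMeasure n σ)))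
    (hg2 : Integrable (fun x ↦ ‖gradient g x‖ ^ 2) (mconv ν (gaussMeasure n σ)))
    {t : ℝ} (ht : 0 < t) :
    ∫ x, ‖gradient (fun y ↦ g y * √(mollDensity ν σ y)) x‖ ^ 2 ∂(gaussMeasure n σ) ≤
      (1 + t⁻¹) * ∫ x, ‖gradient g x‖ ^ 2 ∂(mconv ν (gaussMeasure n σ)) +
        (1 + t) * (R / σ ^ 2) ^ 2 / 4 * ∫ x, g x ^ 2 ∂(mconv ν (gaussMeasure n σ)) := by
  have hi := integrable_norm_gradient_mul_sqrt_sq hν hR hσ hg hg1 hg2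
  rw [integrable_mconv_gaussMeasure_iff hν hR hσ] at hg1 hg2
  rw [integral_mconv_gaussMeasure hν hR hσ, integral_mconv_gaussMeasure hν hR hσ,
    ← integral_const_mul, ← integral_const_mul, ← integral_add (hg2.const_mul _) (hg1.const_mul _)]
  exact integral_mono hi ((hg2.const_mul _).add (hg1.const_mul _)) fun x ↦
    norm_gradient_mul_sqrt_sq_le ((contDiff_mollDensity hν hR hσ).differentiable one_ne_zero x)
      (mollDensity_pos hν hσ x) (hg.differentiable one_ne_zero x)
      (norm_fderiv_mollDensity_le hν hR hσ x) ht

lemma gradient_sub_const {n : ℕ} (f : En n → ℝ) (a : ℝ) :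
    gradient (fun x ↦ f x - a) = gradient f := by
  ext1 x
  simp only [gradient, fderiv_sub_const]

lemma norm_gradient_le_of_lipschitz {n : ℕ} {f : En n → ℝ} {L : NNReal} (hf : LipschitzWith L f)
    (x : En n) : ‖gradient f x‖ ≤ L := by
  rw [gradient, LinearIsometryEquiv.norm_map]
  exact norm_fderiv_le_of_lipschitz ℝ hf


lemma variance_mconv_gaussMeasure_le (hν : ∀ᵐ y ∂ν, ‖y‖ ≤ R) (hR : 0 ≤ R) (hσ : 0 < σ) {ε : ℝ}
    (hε : 0 < ε) (hs : (1 + ε) / 4 * R ^ 2 / σ ^ 2 < 1) {f : En n → ℝ} (hf : ContDiff ℝ 1 f)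
    {M : ℝ} (hM : ∀ x, |f x| ≤ M)
    (hfg : Integrable (fun x ↦ ‖gradient f x‖ ^ 2) (mconv ν (gaussMeasure n σ))) :
    (∫ x, f x ^ 2 ∂(mconv ν (gaussMeasure n σ))) - (∫ x, f x ∂(mconv ν (gaussMeasure n σ))) ^ 2 ≤
      (1 + ε⁻¹) / (1 - (1 + ε) / 4 * R ^ 2 / σ ^ 2) * σ ^ 2 *
        ∫ x, ‖gradient f x‖ ^ 2 ∂(mconv ν (gaussMeasure n σ)) := by
  have := isProbabilityMeasure_gaussMeasure (n := n) hσ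
  have := isProbabilityMeasure_mconv_gaussMeasure (n := n) ν hσ
  set γ := gaussMeasure n σ with hγ
  set p := mconv ν γ with hp
  have hfm := hf.continuous.measurable
  have hsq := integrable_sqrt_mollDensity hν hR hσ
  have hfsq : Integrable (fun x ↦ f x * √(mollDensity ν σ x)) γ :=
    hsq.bdd_mul hf.continuous.aestronglyMeasurable (.of_forall hM)
  have hZ : 0 < ∫ x, √(mollDensity ν σ x) ∂γ := by
    refine (integral_pos_iff_support_of_nonneg (fun x ↦ Real.sqrt_nonneg _) hsq).2 ?_
    rw [show Function.support (fun x ↦ √(mollDensity ν σ x)) = univ from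
      eq_univ_of_forall fun x ↦ (Real.sqrt_pos.2 (mollDensity_pos hν hσ x)).ne']
    simp
  set a := (∫ x, f x * √(mollDensity ν σ x) ∂γ) / ∫ x, √(mollDensity ν σ x) ∂γ with ha
  have hga : ContDiff ℝ 1 fun x ↦ f x - a := hf.sub contDiff_const
  have hga2 : Integrable (fun x ↦ (f x - a) ^ 2) p :=
    integrable_sq_of_abs_le (hfm.sub_const a) fun x ↦
      (abs_sub _ _).trans (add_le_add_left (hM x) |a|)
  have hgag : Integrable (fun x ↦ ‖gradient (fun x ↦ f x - a) x‖ ^ 2) p := by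
    rwa [gradient_sub_const]
  have hmean : ∫ x, (f x - a) * √(mollDensity ν σ x) ∂γ = 0 := by
    simp only [sub_mul]
    rw [integral_sub hfsq (hsq.const_mul a), integral_const_mul, ha, div_mul_cancel₀ _ hZ.ne',
      sub_self]
  have hN := integral_mconv_gaussMeasure hν hR hσ fun x ↦ (f x - a) ^ 2
  have hvar := variance_gaussMeasure_le hσ (contDiff_mul_sqrt_mollDensity hν hR hσ hga)
    (by simp only [sub_mul]; exact hfsq.sub (hsq.const_mul a))
    (by simpa only [mul_sqrt_mollDensity_sq hν hσ (fun x ↦ f x - a)] using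
      (integrable_mconv_gaussMeasure_iff hν hR hσ).1 hga2)
    (integrable_norm_gradient_mul_sqrt_sq hν hR hσ hga hga2 hgag)
  simp only [mul_sqrt_mollDensity_sq hν hσ (fun x ↦ f x - a)] at hvar
  rw [hmean, ← hN] at hvar
  have hgrad := integral_norm_gradient_mul_sqrt_sq_le hν hR hσ hga hga2 hgag hε
  rw [gradient_sub_const] at hgrad
  have hexp := integral_sub_const_sq (μ := p) hfm hM a
  set N := ∫ x, (f x - a) ^ 2 ∂p
  set I := ∫ x, ‖gradient f x‖ ^ 2 ∂p
  have hbound : N * (1 - (1 + ε) / 4 * R ^ 2 / σ ^ 2) ≤ (1 + ε⁻¹) * σ ^ 2 * I := by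
    have h1 := mul_le_mul_of_nonneg_left hgrad (sq_nonneg σ)
    have h2 : σ ^ 2 * ((1 + ε⁻¹) * I + (1 + ε) * (R / σ ^ 2) ^ 2 / 4 * N) =
        (1 + ε⁻¹) * σ ^ 2 * I + (1 + ε) / 4 * R ^ 2 / σ ^ 2 * N := by
      field_simp
    linarith
  have hNle : N ≤ (1 + ε⁻¹) * σ ^ 2 * I / (1 - (1 + ε) / 4 * R ^ 2 / σ ^ 2) :=
    (le_div_iff₀ (by linarith)).2 hbound
  have e : (1 + ε⁻¹) * σ ^ 2 * I / (1 - (1 + ε) / 4 * R ^ 2 / σ ^ 2) =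
      (1 + ε⁻¹) / (1 - (1 + ε) / 4 * R ^ 2 / σ ^ 2) * σ ^ 2 * I := by ring
  linarith [sq_nonneg ((∫ x, f x ∂p) - a)]

/-- The defective logarithmic Sobolev inequality inherited from the Gaussian measure. -/
lemma entropy_sq_sub_mconv_gaussMeasure_le (hν : ∀ᵐ y ∂ν, ‖y‖ ≤ R) (hR : 0 ≤ R) (hσ : 0 < σ)
    {θ : ℝ} (hθ : 0 < θ) {g : En n → ℝ} (hg : ContDiff ℝ 1 g) {M : ℝ} (hM : ∀ x, |g x| ≤ M)
    (hgg : Integrable (fun x ↦ ‖gradient g x‖ ^ 2) (mconv ν (gaussMeasure n σ))) :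
    entropy (mconv ν (gaussMeasure n σ)) (fun x ↦ g x ^ 2) +
        ∫ x, g x ^ 2 * Real.log (mollDensity ν σ x) ∂(mconv ν (gaussMeasure n σ)) ≤
      2 * σ ^ 2 * (1 + θ⁻¹) * ∫ x, ‖gradient g x‖ ^ 2 ∂(mconv ν (gaussMeasure n σ)) +
        (1 + θ) / 2 * (R ^ 2 / σ ^ 2) * ∫ x, g x ^ 2 ∂(mconv ν (gaussMeasure n σ)) := by
  have := isProbabilityMeasure_mconv_gaussMeasure (n := n) ν hσ
  set γ := gaussMeasure n σ with hγ
  set p := mconv ν γ with hp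
  have hgm := hg.continuous.measurable
  have hM2 : ∀ x, |g x ^ 2| ≤ M ^ 2 := fun x ↦ by
    rw [abs_pow]
    exact pow_le_pow_left₀ (abs_nonneg _) (hM x) 2
  have hg2 : Integrable (fun x ↦ g x ^ 2) p := integrable_sq_of_abs_le hgm hM
  have hglog : Integrable (fun x ↦ g x ^ 2 * Real.log (g x ^ 2)) p :=
    integrable_mul_log_of_abs_le (by fun_prop) hM2
  have hglogD : Integrable (fun x ↦ g x ^ 2 * Real.log (mollDensity ν σ x)) p :=
    (integrable_log_mollDensity hν hR hσ).bdd_mul (hg.continuous.pow 2).aestronglyMeasurable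
      (.of_forall hM2)
  have hsplit : ∀ x, g x ^ 2 * mollDensity ν σ x * Real.log (g x ^ 2 * mollDensity ν σ x) =
      (g x ^ 2 * Real.log (g x ^ 2) + g x ^ 2 * Real.log (mollDensity ν σ x)) *
        mollDensity ν σ x := fun x ↦ by
    by_cases hx : g x = 0
    · simp [hx]
    · rw [Real.log_mul (pow_ne_zero 2 hx) (mollDensity_pos hν hσ x).ne']
      ring
  have h := entropy_sq_gaussMeasure_le hσ (contDiff_mul_sqrt_mollDensity hν hR hσ hg)
    (by simpa only [mul_sqrt_mollDensity_sq hν hσ] using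
      (integrable_mconv_gaussMeasure_iff hν hR hσ).1 hg2)
    (by simp only [mul_sqrt_mollDensity_sq hν hσ, hsplit]
        exact (integrable_mconv_gaussMeasure_iff hν hR hσ).1 (hglog.add hglogD))
    (integrable_norm_gradient_mul_sqrt_sq hν hR hσ hg hg2 hgg)
  simp only [mul_sqrt_mollDensity_sq hν hσ, entropy, hsplit] at h
  rw [← integral_mconv_gaussMeasure hν hR hσ (fun x ↦ g x ^ 2),
    ← integral_mconv_gaussMeasure hν hR hσ
      (fun x ↦ g x ^ 2 * Real.log (g x ^ 2) + g x ^ 2 * Real.log (mollDensity ν σ x)),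
    integral_add hglog hglogD] at h
  have hgrad := integral_norm_gradient_mul_sqrt_sq_le hν hR hσ hg hg2 hgg hθ
  have h1 := mul_le_mul_of_nonneg_left hgrad (by positivity : 0 ≤ 2 * σ ^ 2)
  simp only [entropy]
  have e : ∀ I N : ℝ, 2 * σ ^ 2 * ((1 + θ⁻¹) * I + (1 + θ) * (R / σ ^ 2) ^ 2 / 4 * N) =
      2 * σ ^ 2 * (1 + θ⁻¹) * I + (1 + θ) / 2 * (R ^ 2 / σ ^ 2) * N := fun I N ↦ by
    field_simp
    ring
  rw [e] at h1
  linarith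

/-- The density is controlled by the entropy, through its negative exponential moments. -/
lemma neg_integral_sq_mul_log_mollDensity_le (hν : ∀ᵐ y ∂ν, ‖y‖ ≤ R) (hR : 0 ≤ R) (hσ : 0 < σ)
    {β : ℝ} (hβ : 0 ≤ β) {g : En n → ℝ} (hg : Continuous g) {M : ℝ} (hM : ∀ x, |g x| ≤ M) :
    -((1 + β) * ∫ x, g x ^ 2 * Real.log (mollDensity ν σ x) ∂(mconv ν (gaussMeasure n σ))) ≤
      entropy (mconv ν (gaussMeasure n σ)) (fun x ↦ g x ^ 2) +
        β * (1 + β) / 2 * (R ^ 2 / σ ^ 2) * ∫ x, g x ^ 2 ∂(mconv ν (gaussMeasure n σ)) := by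
  have := isProbabilityMeasure_mconv_gaussMeasure (n := n) ν hσ
  set γ := gaussMeasure n σ with hγ
  set p := mconv ν γ with hp
  have hgm := hg.measurable
  have hM2 : ∀ x, |g x ^ 2| ≤ M ^ 2 := fun x ↦ by
    rw [abs_pow]
    exact pow_le_pow_left₀ (abs_nonneg _) (hM x) 2
  have hg2 : Integrable (fun x ↦ g x ^ 2) p := integrable_sq_of_abs_le hgm hM
  have hglog : Integrable (fun x ↦ g x ^ 2 * Real.log (g x ^ 2)) p :=
    integrable_mul_log_of_abs_le (by fun_prop) hM2
  have hglogD : Integrable (fun x ↦ g x ^ 2 * Real.log (mollDensity ν σ x)) p :=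
    (integrable_log_mollDensity hν hR hσ).bdd_mul (hg.pow 2).aestronglyMeasurable
      (.of_forall hM2)
  rcases (integral_nonneg fun x ↦ sq_nonneg (g x) : 0 ≤ ∫ x, g x ^ 2 ∂p).eq_or_lt with h0 | h0
  · have hae := (integral_eq_zero_iff_of_nonneg (fun x ↦ sq_nonneg (g x)) hg2).1 h0.symm
    have hz : ∀ w : En n → ℝ, ∫ x, g x ^ 2 * w x ∂p = 0 := fun w ↦
      integral_eq_zero_of_ae (hae.mono fun x hx ↦ by
        have hx' : g x ^ 2 = 0 := hx
        simp [hx'])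
    simp [entropy, hz, ← h0]
  have hGD : ∀ x, Real.exp (-((1 + β) * Real.log (mollDensity ν σ x))) * mollDensity ν σ x =
      Real.exp (-(β * Real.log (mollDensity ν σ x))) := fun x ↦ by
    nth_rewrite 2 [← Real.exp_log (mollDensity_pos hν hσ x)]
    rw [← Real.exp_add]
    congr 1
    ring
  have hGi : Integrable (fun x ↦ Real.exp (-((1 + β) * Real.log (mollDensity ν σ x)))) p := by
    rw [hp, hγ, integrable_mconv_gaussMeasure_iff hν hR hσ]
    simpa only [hGD] using integrable_exp_neg_mul_log_mollDensity hν hR hσ hβ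
  have e : ∀ x, g x ^ 2 * -((1 + β) * Real.log (mollDensity ν σ x)) =
      -(1 + β) * (g x ^ 2 * Real.log (mollDensity ν σ x)) := fun x ↦ by ring
  have h := integral_mul_log_sub_le_entropy p (fun x ↦ sq_nonneg (g x)) hg2 hglog
    (fun x ↦ Real.exp_pos _) hGi
    (by simpa only [Real.log_exp, e] using hglogD.const_mul (-(1 + β))) h0
  simp only [Real.log_exp, e] at h
  rw [integral_const_mul, hp, hγ, integral_mconv_gaussMeasure hν hR hσ
    (fun x ↦ Real.exp (-((1 + β) * Real.log (mollDensity ν σ x)))), ← hγ, ← hp] at h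
  simp only [hGD] at h
  have hlog : Real.log (∫ x, Real.exp (-(β * Real.log (mollDensity ν σ x))) ∂γ) ≤
      β * (1 + β) * (R ^ 2 / (2 * σ ^ 2)) := by
    have := isProbabilityMeasure_gaussMeasure (n := n) hσ
    rw [Real.log_le_iff_le_exp
      (integral_exp_pos (integrable_exp_neg_mul_log_mollDensity hν hR hσ hβ))]
    exact integral_exp_neg_mul_log_mollDensity_le hν hR hσ hβ
  have h2 := mul_le_mul_of_nonneg_left hlog h0.le
  have e2 : (∫ x, g x ^ 2 ∂p) * (β * (1 + β) * (R ^ 2 / (2 * σ ^ 2))) =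
      β * (1 + β) / 2 * (R ^ 2 / σ ^ 2) * ∫ x, g x ^ 2 ∂p := by
    field_simp
  linarith

end MollifiedMeasure

end

/-- For `ν` supported in `B(0,R)` and `ν^σ = ν * γ_σ`, if
`s := (1+ε)/4 · R²/σ² < 1` then `C_P(ν^σ) ≤ (1+ε⁻¹)/(1-s) · σ²`, and for all
`θ, β > 0` the stated log-Sobolev bound holds. -/
theorem poincare_logSobolev_of_gaussian_mollification
    {n : ℕ} (ν : Measure (En n)) [IsProbabilityMeasure ν]
    (R σ : ℝ) (hR : 0 ≤ R) (hσ : 0 < σ)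
    (hsupp : measSupport ν ⊆ Metric.closedBall (0 : En n) R)
    (ε : ℝ) (hε : 0 < ε)
    (hs : (1 + ε) / 4 * R ^ 2 / σ ^ 2 < 1) :
    PoincareLE (mconv ν (gaussMeasure n σ))
      ((1 + ε⁻¹) / (1 - (1 + ε) / 4 * R ^ 2 / σ ^ 2) * σ ^ 2) ∧
    ∀ θ β : ℝ, 0 < θ → 0 < β →
      LogSobolevLE (mconv ν (gaussMeasure n σ))
        ((2 * (β + 1) * (1 + θ⁻¹) / β
            + 5 * ((1 + ε⁻¹) / (1 - (1 + ε) / 4 * R ^ 2 / σ ^ 2))) * σ ^ 2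
          + 2 * ((1 + ε⁻¹) / (1 - (1 + ε) / 4 * R ^ 2 / σ ^ 2)) *
            ((1 + θ) * (1 + β) / (4 * β) + β ^ 2 / 2) * R ^ 2) := by
  have hν := ae_norm_le_of_measSupport_subset hsupp
  have hprob := isProbabilityMeasure_mconv_gaussMeasure (n := n) ν hσ
  have hgrad : ∀ f : En n → ℝ, IsTestFun f →
      Integrable (fun x ↦ ‖gradient f x‖ ^ 2) (mconv ν (gaussMeasure n σ)) := by
    rintro f ⟨hf, -, L, hL⟩
    refine integrable_of_abs_le (M := (L : ℝ) ^ 2)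
      (continuous_norm_gradient_sq (hf.of_le (by simp))).measurable fun x ↦ ?_
    rw [abs_of_nonneg (by positivity)]
    exact pow_le_pow_left₀ (norm_nonneg _) (norm_gradient_le_of_lipschitz hL x) 2
  refine ⟨fun f hf ↦ ?_, fun θ β hθ hβ f hf ↦ ?_⟩
  · obtain ⟨M, hM⟩ := hf.2.1
    exact variance_mconv_gaussMeasure_le hν hR hσ hε hs (hf.1.of_le (by simp)) hM (hgrad f hf)
  obtain ⟨M, hM⟩ := hf.2.1
  have hf1 : ContDiff ℝ 1 f := hf.1.of_le (by simp)
  have hfm := hf1.continuous.measurable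
  set p := mconv ν (gaussMeasure n σ) with hp
  have hvar := variance_mconv_gaussMeasure_le hν hR hσ hε hs hf1 hM (hgrad f hf)
  have hRoth := entropy_sq_le_entropy_sub_mean_sq p hfm hM
  set a := ∫ x, f x ∂p with ha
  have hMa : ∀ x, |f x - a| ≤ M + |a| := fun x ↦
    (abs_sub _ _).trans (add_le_add_left (hM x) _)
  have hga : ContDiff ℝ 1 fun x ↦ f x - a := hf1.sub contDiff_const
  have hDLS := entropy_sq_sub_mconv_gaussMeasure_le hν hR hσ hθ hga hMa
    (by rw [gradient_sub_const]; exact hgrad f hf)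
  have hdual := neg_integral_sq_mul_log_mollDensity_le hν hR hσ hβ.le hga.continuous hMa
  rw [gradient_sub_const] at hDLS
  have hN : ∫ x, (f x - a) ^ 2 ∂p = (∫ x, f x ^ 2 ∂p) - a ^ 2 := by
    rw [integral_sub_const_sq hfm hM a, ← ha]
    ring
  rw [← hN] at hvar
  have hN0 : 0 ≤ ∫ x, (f x - a) ^ 2 ∂p := integral_nonneg fun x ↦ sq_nonneg _
  change entropy p (fun x ↦ f x ^ 2) ≤ _
  generalize entropy p (fun x ↦ f x ^ 2) = E at *
  generalize entropy p (fun x ↦ (f x - a) ^ 2) = E' at *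
  generalize ∫ x, (f x - a) ^ 2 ∂p = N at *
  generalize ∫ x, ‖gradient f x‖ ^ 2 ∂p = I at *
  generalize ∫ x, (f x - a) ^ 2 * Real.log (mollDensity ν σ x) ∂p = S at *
  have hσ2 : σ ^ 2 ≠ 0 := by positivity
  set C := (1 + ε⁻¹) / (1 - (1 + ε) / 4 * R ^ 2 / σ ^ 2) with hC
  set r := R ^ 2 / σ ^ 2 with hr
  have hr0 : 0 ≤ r := by positivity
  have hr4 : r < 4 := by
    have : (1 + ε) / 4 * R ^ 2 / σ ^ 2 = (1 + ε) / 4 * r := by rw [hr]; ring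
    nlinarith
  have hRr : R ^ 2 = r * σ ^ 2 := by rw [hr]; field_simp
  have hE' : E' ≤ (1 + β) / β * (2 * σ ^ 2 * (1 + θ⁻¹) * I + (1 + θ) / 2 * r * N) +
      (1 + β) / 2 * r * N := by
    have h1 := mul_le_mul_of_nonneg_left hDLS (by positivity : 0 ≤ 1 + β)
    have h2 : β * E' ≤ (1 + β) * (2 * σ ^ 2 * (1 + θ⁻¹) * I + (1 + θ) / 2 * r * N) +
        β * (1 + β) / 2 * r * N := by linarith
    have h3 : E' ≤ ((1 + β) * (2 * σ ^ 2 * (1 + θ⁻¹) * I + (1 + θ) / 2 * r * N) +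
        β * (1 + β) / 2 * r * N) / β := by
      rw [le_div_iff₀ hβ]
      linarith
    refine h3.trans_eq ?_
    field_simp
  have hcoef : (1 + β) / β * ((1 + θ) / 2 * r) + (1 + β) / 2 * r + 2 ≤
      5 + 2 * ((1 + θ) * (1 + β) / (4 * β) + β ^ 2 / 2) * r := by
    have e : (1 + β) / β * ((1 + θ) / 2 * r) = 2 * ((1 + θ) * (1 + β) / (4 * β)) * r := by
      field_simp
      ring
    have h1 : r * (1 / 2 + β / 2 - β ^ 2) ≤ r * (9 / 16) :=
      mul_le_mul_of_nonneg_left (by nlinarith [sq_nonneg (β - 1 / 4)]) hr0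
    linarith
  have hNbound := (mul_le_mul_of_nonneg_right hcoef hN0).trans
    (mul_le_mul_of_nonneg_left hvar (by positivity))
  have hfin : ((2 * (β + 1) * (1 + θ⁻¹) / β + 5 * C) * σ ^ 2 +
      2 * C * ((1 + θ) * (1 + β) / (4 * β) + β ^ 2 / 2) * R ^ 2) * I =
      (1 + β) / β * (2 * σ ^ 2 * (1 + θ⁻¹) * I) +
      (5 + 2 * ((1 + θ) * (1 + β) / (4 * β) + β ^ 2 / 2) * r) * (C * σ ^ 2 * I) := by
    rw [hRr]
    ring
  rw [hfin]
  linarith
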